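/- arXiv:2003.10231 — 4 statements merged into one kernel-verified Lean document; each statement's English description precedes it below -/
import Mathlib

section
/- Let 0 < k < n and let P be a positive tropical Plücker vector on the k-subsets of [n] such that for every (k−2)-element subset S of [n] and all a < b < c < d in [n] ∖ S one has P(S∪{a,b}) + P(S∪{c,d}) ≠ P(S∪{a,d}) + P(S∪{b,c}) (i.e., the regular positroidal subdivision D_P is finest). Then the number of distinct sets of the form Face_P(λ), λ ∈ ℝⁿ, for which the polytope conv{ e_I : I ∈ Face_P(λ) } ⊂ ℝⁿ has affine dimension n−1, equals the binomial coefficient C(n−2, k−1). (A finest positroidal subdivision of Δ_{k,n} has exactly C(n−2,k−1) facets, achieving equality in the f-vector theorem.) -/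
/-- `P` is a positive tropical Plücker vector. -/
def IsPosTropPlucker (n k : ℕ) (P : Finset (Fin n) → ℝ) : Prop :=
  ∀ S : Finset (Fin n), S.card + 2 = k →
    ∀ a b c d : Fin n, a < b → b < c → c < d →
      a ∉ S → b ∉ S → c ∉ S → d ∉ S →
      ((P (S ∪ {a, c}) + P (S ∪ {b, d}) = P (S ∪ {a, b}) + P (S ∪ {c, d}) ∧
        P (S ∪ {a, b}) + P (S ∪ {c, d}) ≤ P (S ∪ {a, d}) + P (S ∪ {b, c})) ∨
       (P (S ∪ {a, c}) + P (S ∪ {b, d}) = P (S ∪ {a, d}) + P (S ∪ {b, c}) ∧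
        P (S ∪ {a, d}) + P (S ∪ {b, c}) ≤ P (S ∪ {a, b}) + P (S ∪ {c, d})))

/-- The vertex set of the face of the regular subdivision `D_P` of the hypersimplex
selected by `λ`: the `k`-subsets `I` maximizing `∑_{i ∈ I} λ_i - P(I)`. -/
def FaceOf (n k : ℕ) (P : Finset (Fin n) → ℝ) (lam : Fin n → ℝ) : Set (Finset (Fin n)) :=
  {I | I.card = k ∧ ∀ J : Finset (Fin n), J.card = k →
    (∑ i ∈ J, lam i) - P J ≤ (∑ i ∈ I, lam i) - P I}

/-- The polytope spanned by the indicator vectors of a family of subsets of `[n]`. -/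
noncomputable def familyPolytope (n : ℕ) (ℬ : Set (Finset (Fin n))) : Set (Fin n → ℝ) :=
  convexHull ℝ {x : Fin n → ℝ | ∃ I ∈ ℬ, x = fun i => if i ∈ I then (1 : ℝ) else 0}

namespace PosTrop

section Exchange

set_option linter.unusedSectionVars false

variable {α : Type*} [LinearOrder α]

/-- The set obtained from `B` by exchanging `i` for `j`. -/
def exch (B : Finset α) (i j : α) : Finset α := insert j (B.erase i)

/-- The function induced by `f` on the contraction of `e`. -/
def contr (f : Finset α → ℝ) (e : α) : Finset α → ℝ := fun I => f (insert e I)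

/-- The max-plus form of the positive three-term relations on the `k`-subsets of `E`, together with
the absence of uncut octahedra. -/
def Generic (E : Finset α) (k : ℕ) (f : Finset α → ℝ) : Prop :=
  ∀ S ⊆ E, S.card + 2 = k → ∀ a ∈ E, ∀ b ∈ E, ∀ c ∈ E, ∀ d ∈ E, a < b → b < c → c < d →
    a ∉ S → b ∉ S → c ∉ S → d ∉ S →
    f (insert a (insert c S)) + f (insert b (insert d S)) =
      max (f (insert a (insert b S)) + f (insert c (insert d S)))
        (f (insert a (insert d S)) + f (insert b (insert c S))) ∧
    f (insert a (insert b S)) + f (insert c (insert d S)) ≠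
      f (insert a (insert d S)) + f (insert b (insert c S))

/-- `B` maximizes `f` among the `k`-subsets of `E`. -/
def Top (E : Finset α) (k : ℕ) (f : Finset α → ℝ) (B : Finset α) : Prop :=
  B ⊆ E ∧ B.card = k ∧ ∀ I ⊆ E, I.card = k → f I ≤ f B

/-- No proper nonempty subset of `E` meets all maximizers of `f` in the same number of elements. -/
def Conn (E : Finset α) (k : ℕ) (f : Finset α → ℝ) : Prop :=
  (∃ B, Top E k f B) ∧ ∀ C ⊆ E, C.Nonempty → C ≠ E →
    ∃ B B', Top E k f B ∧ Top E k f B' ∧ (B ∩ C).card ≠ (B' ∩ C).card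

variable {E B C I S : Finset α} {k : ℕ} {f : Finset α → ℝ} {a b c d e i j i' j' : α}

lemma card_exch (hi : i ∈ B) (hj : j ∉ B) : (exch B i j).card = B.card := by
  have h : j ∉ B.erase i := fun h => hj (Finset.mem_of_mem_erase h)
  rw [exch, Finset.card_insert_of_notMem h, Finset.card_erase_of_mem hi]
  have := Finset.card_pos.mpr ⟨i, hi⟩
  omega

lemma exch_subset (hB : B ⊆ E) (hj : j ∈ E) : exch B i j ⊆ E :=
  Finset.insert_subset hj ((Finset.erase_subset _ _).trans hB)

lemma mem_exch {x : α} : x ∈ exch B i j ↔ x = j ∨ x ≠ i ∧ x ∈ B := by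
  simp [exch]

lemma sum_exch (μ : α → ℝ) (hi : i ∈ B) (hj : j ∉ B) :
    ∑ x ∈ exch B i j, μ x = ∑ x ∈ B, μ x - μ i + μ j := by
  have h : j ∉ B.erase i := fun h => hj (Finset.mem_of_mem_erase h)
  rw [exch, Finset.sum_insert h, ← Finset.add_sum_erase B μ hi]
  ring

lemma Generic.add_sum (hf : Generic E k f) (μ : α → ℝ) :
    Generic E k (fun I => f I + ∑ x ∈ I, μ x) := by
  intro S hS hk a ha b hb c hc d hd hab hbc hcd haS hbS hcS hdS
  have h := hf S hS hk a ha b hb c hc d hd hab hbc hcd haS hbS hcS hdS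
  have hs : ∀ x y, x ∉ S → y ∉ S → x ≠ y →
      ∑ z ∈ insert x (insert y S), μ z = μ x + μ y + ∑ z ∈ S, μ z := by
    intro x y hx hy hxy
    rw [Finset.sum_insert (by simp [hx, hxy]), Finset.sum_insert hy]
    ring
  have hac := hab.trans hbc
  have hbd := hbc.trans hcd
  have had := hac.trans hcd
  simp only [hs a b haS hbS hab.ne, hs a c haS hcS hac.ne, hs a d haS hdS had.ne,
    hs b c hbS hcS hbc.ne, hs b d hbS hdS hbd.ne, hs c d hcS hdS hcd.ne]
  obtain ⟨h1, h2⟩ := h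
  constructor
  · rcases max_cases (f (insert a (insert b S)) + f (insert c (insert d S)))
        (f (insert a (insert d S)) + f (insert b (insert c S))) with h | h
    · rw [max_eq_left (by linarith)]; linarith
    · rw [max_eq_right (by linarith)]; linarith
  · intro h
    apply h2
    linarith

lemma Generic.erase (hf : Generic E k f) (e : α) : Generic (E.erase e) k f := by
  intro S hS hk a ha b hb c hc d hd
  exact hf S (hS.trans (Finset.erase_subset _ _)) hk a (Finset.mem_of_mem_erase ha)
    b (Finset.mem_of_mem_erase hb) c (Finset.mem_of_mem_erase hc) d (Finset.mem_of_mem_erase hd)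

lemma Generic.contr (hf : Generic E (k + 1) f) (he : e ∈ E) :
    Generic (E.erase e) k (contr f e) := by
  intro S hS hk a ha b hb c hc d hd hab hbc hcd haS hbS hcS hdS
  have heS : e ∉ S := fun h => by simpa using hS h
  have hne : ∀ x ∈ E.erase e, x ∉ S → x ∉ insert e S := by
    intro x hx hxS
    simp [hxS, Finset.ne_of_mem_erase hx]
  have h := hf (insert e S) (Finset.insert_subset he (hS.trans (Finset.erase_subset _ _)))
    (by rw [Finset.card_insert_of_notMem heS]; omega)
    a (Finset.mem_of_mem_erase ha) b (Finset.mem_of_mem_erase hb) c (Finset.mem_of_mem_erase hc)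
    d (Finset.mem_of_mem_erase hd) hab hbc hcd (hne a ha haS) (hne b hb hbS) (hne c hc hcS)
    (hne d hd hdS)
  have hs : ∀ x y, insert x (insert y (insert e S)) = insert e (insert x (insert y S)) := by
    intro x y
    rw [Finset.insert_comm y e, Finset.insert_comm x e]
  simpa only [hs, PosTrop.contr] using h

/-- The three-term relation without reference to the order. -/
lemma Generic.three_term (hf : Generic E k f) (hS : S ⊆ E) (hk : S.card + 2 = k)
    (ha : a ∈ E) (hb : b ∈ E) (hc : c ∈ E) (hd : d ∈ E)
    (haS : a ∉ S) (hbS : b ∉ S) (hcS : c ∉ S) (hdS : d ∉ S)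
    (hab : a ≠ b) (hac : a ≠ c) (had : a ≠ d) (hbc : b ≠ c) (hbd : b ≠ d) (hcd : c ≠ d) :
    f (insert a (insert b S)) + f (insert c (insert d S)) ≤
      max (f (insert a (insert c S)) + f (insert b (insert d S)))
        (f (insert a (insert d S)) + f (insert b (insert c S))) := by
  have hsym : ∀ x y, f (insert x (insert y S)) = f (insert y (insert x S)) := fun x y => by
    rw [Finset.insert_comm]
  have H : ∀ a b c d, (a ∈ E ∧ a ∉ S) → (b ∈ E ∧ b ∉ S) → (c ∈ E ∧ c ∉ S) → (d ∈ E ∧ d ∉ S) →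
      a < b → b < c → c < d → f (insert a (insert c S)) + f (insert b (insert d S)) =
      max (f (insert a (insert b S)) + f (insert c (insert d S)))
        (f (insert a (insert d S)) + f (insert b (insert c S))) :=
    fun a b c d ha hb hc hd hab hbc hcd =>
      (hf S hS hk a ha.1 b hb.1 c hc.1 d hd.1 hab hbc hcd ha.2 hb.2 hc.2 hd.2).1
  generalize hg : (fun x y => f (insert x (insert y S))) = g
  have hg' : ∀ x y, f (insert x (insert y S)) = g x y := fun x y => by rw [← hg]
  simp only [hg'] at hsym H ⊢
  have K : ∀ a b c d, (a ∈ E ∧ a ∉ S) → (b ∈ E ∧ b ∉ S) → (c ∈ E ∧ c ∉ S) → (d ∈ E ∧ d ∉ S) →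
      a < b → c < d → a < c → b ≠ c → b ≠ d →
      g a b + g c d ≤ max (g a c + g b d) (g a d + g b c) := by
    intro a b c d ha hb hc hd hab hcd hac hbc hbd
    rcases hbc.lt_or_gt with h | h
    · rw [H a b c d ha hb hc hd hab h hcd]
      exact (le_max_left _ _).trans (le_max_left _ _)
    · rcases hbd.lt_or_gt with h' | h'
      · rw [H a c b d ha hc hb hd hac h h', hsym c b]
      · have := H a c d b ha hc hd hb hac hcd h'
        rw [hsym c b, hsym d b] at this
        rw [this]
        exact (le_max_right _ _).trans (le_max_right _ _)
  have K' : ∀ a b c d, (a ∈ E ∧ a ∉ S) → (b ∈ E ∧ b ∉ S) → (c ∈ E ∧ c ∉ S) → (d ∈ E ∧ d ∉ S) →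
      a < b → c < d → a ≠ c → a ≠ d → b ≠ c → b ≠ d →
      g a b + g c d ≤ max (g a c + g b d) (g a d + g b c) := by
    intro a b c d ha hb hc hd hab hcd hac had hbc hbd
    rcases hac.lt_or_gt with h | h
    · exact K a b c d ha hb hc hd hab hcd h hbc hbd
    · have := K c d a b hc hd ha hb hcd hab h had.symm hbd.symm
      rwa [hsym c a, hsym d b, hsym c b, hsym d a, add_comm, add_comm (g b c)] at this
  rcases hab.lt_or_gt with h | h <;> rcases hcd.lt_or_gt with h' | h'
  · exact K' a b c d ⟨ha, haS⟩ ⟨hb, hbS⟩ ⟨hc, hcS⟩ ⟨hd, hdS⟩ h h' hac had hbc hbd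
  · rw [hsym c d, max_comm]
    exact K' a b d c ⟨ha, haS⟩ ⟨hb, hbS⟩ ⟨hd, hdS⟩ ⟨hc, hcS⟩ h h' had hac hbd hbc
  · rw [hsym a b, max_comm, add_comm (g a d), add_comm (g a c)]
    exact K' b a c d ⟨hb, hbS⟩ ⟨ha, haS⟩ ⟨hc, hcS⟩ ⟨hd, hdS⟩ h h' hbc hbd hac had
  · rw [hsym a b, hsym c d, add_comm (g a d), add_comm (g a c)]
    exact K' b a d c ⟨hb, hbS⟩ ⟨ha, haS⟩ ⟨hd, hdS⟩ ⟨hc, hcS⟩ h h' hbd hbc had hac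

lemma Top.eq_of_top {B' : Finset α} (hB : Top E k f B) (hB' : Top E k f B') : f B = f B' :=
  le_antisymm (hB'.2.2 B hB.1 hB.2.1) (hB.2.2 B' hB'.1 hB'.2.1)

lemma Top.of_eq (hB : Top E k f B) (hI : I ⊆ E) (hk : I.card = k) (h : f B ≤ f I) :
    Top E k f I :=
  ⟨hI, hk, fun J hJ hJk => (hB.2.2 J hJ hJk).trans h⟩

/-- Two elements of a set can be split off. -/
lemma exists_eq_insert_insert (hB : B ⊆ E) (hk : B.card = k) (hi : i ∈ B) (hi' : i' ∈ B)
    (h : i ≠ i') : ∃ S ⊆ E, S.card + 2 = k ∧ i ∉ S ∧ i' ∉ S ∧ B = insert i (insert i' S) := by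
  refine ⟨(B.erase i).erase i', ?_, ?_, by simp, by simp, ?_⟩
  · exact ((Finset.erase_subset _ _).trans (Finset.erase_subset _ _)).trans hB
  · have h1 : i' ∈ B.erase i := Finset.mem_erase.mpr ⟨h.symm, hi'⟩
    have := Finset.card_erase_add_one h1
    have := Finset.card_erase_add_one hi
    omega
  · rw [Finset.insert_erase (Finset.mem_erase.mpr ⟨h.symm, hi'⟩), Finset.insert_erase hi]

lemma exch_insert_left (hi : i ∉ S) (h : i ≠ i') :
    exch (insert i (insert i' S)) i j = insert j (insert i' S) := by
  rw [exch, Finset.erase_insert (by simp [hi, h])]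

lemma exch_insert_right (hi : i' ∉ S) (h : i ≠ i') :
    exch (insert i (insert i' S)) i' j = insert j (insert i S) := by
  rw [Finset.insert_comm, exch_insert_left hi h.symm]

lemma exch_exch_insert (hi : i ∉ S) (hi' : i' ∉ S) (h : i ≠ i') (hj : i' ≠ j) :
    exch (exch (insert i (insert i' S)) i j) i' j' = insert j (insert j' S) := by
  rw [exch_insert_left hi h, exch_insert_right hi' hj.symm, Finset.insert_comm]

lemma Generic.exchange_le (hf : Generic E k f) (hB : B ⊆ E) (hk : B.card = k)
    (hi : i ∈ B) (hi' : i' ∈ B) (h : i ≠ i') (hj : j ∈ E) (hjB : j ∉ B) (hj' : j' ∈ E)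
    (hjB' : j' ∉ B) (h' : j ≠ j') :
    f B + f (exch (exch B i j) i' j') ≤
      max (f (exch B i j) + f (exch B i' j')) (f (exch B i j') + f (exch B i' j)) := by
  have hiE := hB hi
  have hiE' := hB hi'
  obtain ⟨S, hS, hSk, hiS, hiS', rfl⟩ := exists_eq_insert_insert hB hk hi hi' h
  simp only [Finset.mem_insert, not_or] at hjB hjB'
  have := hf.three_term hS hSk hiE hiE' hj hj' hiS hiS' hjB.2.2 hjB'.2.2 h (Ne.symm hjB.1)
    (Ne.symm hjB'.1) (Ne.symm hjB.2.1) (Ne.symm hjB'.2.1) h'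
  rw [exch_exch_insert hiS hiS' h (Ne.symm hjB.2.1), exch_insert_left hiS h,
    exch_insert_left hiS h, exch_insert_right hiS' h, exch_insert_right hiS' h]
  rw [max_comm, Finset.insert_comm j i', Finset.insert_comm j' i, Finset.insert_comm j' i',
    Finset.insert_comm j i, add_comm (f (insert i' (insert j S))),
    add_comm (f (insert i' (insert j' S)))]
  exact this

/-- A local maximum relative to `I` is at least as large as the value at `I`. -/
lemma Generic.le_of_local (hf : Generic E k f) (hB : B ⊆ E) (hk : B.card = k) (hI : I ⊆ E)
    (hIk : I.card = k) (h : ∀ i ∈ B, i ∉ I → ∀ j ∈ I, j ∉ B → f (exch B i j) ≤ f B) :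
    f I ≤ f B := by
  induction hn : (I \ B).card generalizing B f with
  | zero =>
    rw [Finset.card_eq_zero, Finset.sdiff_eq_empty_iff_subset] at hn
    rw [Finset.eq_of_subset_of_card_le hn (by omega)]
  | succ n ih =>
    obtain ⟨a, ha⟩ : (I \ B).Nonempty := Finset.card_pos.mp (by omega)
    rw [Finset.mem_sdiff] at ha
    have hne : (B \ I).Nonempty := by
      rw [← Finset.card_pos]
      have := Finset.card_sdiff_add_card_inter I B
      have := Finset.card_sdiff_add_card_inter B I
      rw [Finset.inter_comm] at this
      omega
    obtain ⟨i₀, hi₀, hmax⟩ := Finset.exists_max_image _ (fun i => f (exch B i a)) hne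
    rw [Finset.mem_sdiff] at hi₀
    set t := f B - f (exch B i₀ a) with ht
    have ht0 : 0 ≤ t := sub_nonneg.mpr (h i₀ hi₀.1 hi₀.2 a ha.1 ha.2)
    set μ : α → ℝ := fun x => if x = a then t else 0 with hμ
    set g : Finset α → ℝ := fun J => f J + ∑ x ∈ J, μ x with hg
    have hsum : ∀ J : Finset α, ∑ x ∈ J, μ x = if a ∈ J then t else 0 := by
      intro J
      simp [hμ]
    have hgf : Generic E k g := hf.add_sum μ
    have hgB : g B = f B := by simp [hg, hsum, ha.2]
    have hlocal : ∀ i ∈ B, i ∉ I → ∀ j ∈ I, j ∉ B → g (exch B i j) ≤ g B := by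
      intro i hi hiI j hj hjB
      rw [hgB]
      by_cases hja : j = a
      · subst hja
        have := hmax i (Finset.mem_sdiff.mpr ⟨hi, hiI⟩)
        simp only [hg, hsum, mem_exch, true_or, if_true]
        linarith
      · have : a ∉ exch B i j := by
          rw [mem_exch]; rintro (h | h)
          · exact hja h.symm
          · exact ha.2 h.2
        simpa [hg, hsum, this] using h i hi hiI j hj hjB
    have hgB' : g (exch B i₀ a) = g B := by
      rw [hgB]
      simp [hg, hsum, mem_exch, ht]
    have hgI : g I = f I + t := by simp [hg, hsum, ha.1]
    have key : g I ≤ g (exch B i₀ a) := by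
      refine ih hgf (exch_subset hB (hI ha.1)) (by rw [card_exch hi₀.1 ha.2, hk]) ?_ ?_
      · intro i hi hiI j hj hjB
        rw [mem_exch] at hi
        rcases hi with rfl | ⟨hne, hi⟩
        · exact absurd ha.1 hiI
        have hja : j ≠ a := by rintro rfl; exact hjB (by simp [mem_exch])
        have hjB' : j ∉ B := fun hjB' => hjB (by
          rw [mem_exch]; exact Or.inr ⟨by rintro rfl; exact hi₀.2 hj, hjB'⟩)
        have h1 := hgf.exchange_le hB hk hi₀.1 hi hne.symm (hI ha.1) ha.2 (hI hj) hjB' hja.symm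
        have h2 := hlocal i hi hiI j hj hjB'
        have h3 := hlocal i₀ hi₀.1 hi₀.2 j hj hjB'
        have h4 := hlocal i hi hiI a ha.1 ha.2
        rcases le_max_iff.mp h1 with h1 | h1 <;> linarith
      · have : I \ exch B i₀ a = (I \ B).erase a := by
          ext x
          simp only [Finset.mem_sdiff, mem_exch, Finset.mem_erase]
          constructor
          · rintro ⟨h1, h2⟩
            push Not at h2
            exact ⟨h2.1, h1, fun h3 => h2.2 (by rintro rfl; exact hi₀.2 h1) h3⟩
          · rintro ⟨h1, h2, h3⟩
            exact ⟨h2, by tauto⟩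
        rw [this, Finset.card_erase_of_mem (Finset.mem_sdiff.mpr ha), hn]
        rfl
    linarith

/-- If `f` has a connected set of maximizers, then for every maximizer `B` and every proper
nonempty `C` some exchange at `B` leads across the boundary of `C`. -/
lemma Conn.exists_exch (hf : Generic E k f) (hc : Conn E k f) (hB : Top E k f B) (hC : C ⊆ E)
    (hC0 : C.Nonempty) (hCE : C ≠ E) :
    ∃ i ∈ B, ∃ j ∈ E, j ∉ B ∧ Top E k f (exch B i j) ∧ (i ∈ C ↔ j ∉ C) := by
  by_contra! hno
  obtain ⟨δ, hδ, hgap⟩ : ∃ δ > 0, ∀ I ⊆ E, I.card = k → ¬ Top E k f I → f I + δ ≤ f B := by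
    classical
    by_cases hne : ((E.powersetCard k).filter fun I => ¬ Top E k f I).Nonempty
    · obtain ⟨J, hJ, hJmax⟩ := Finset.exists_max_image _ f hne
      simp only [Finset.mem_filter, Finset.mem_powersetCard] at hJ hJmax
      refine ⟨f B - f J, ?_, fun I hI hIk hIT => ?_⟩
      · have : ¬ f B ≤ f J := fun h => hJ.2 (hB.of_eq hJ.1.1 hJ.1.2 h)
        linarith
      · have := hJmax I ⟨⟨hI, hIk⟩, hIT⟩
        linarith
    · refine ⟨1, one_pos, fun I hI hIk hIT => absurd ?_ hne⟩
      exact ⟨I, by simp [hI, hIk, hIT]⟩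
  have main : ∀ s : ℝ, |s| ≤ δ → ∀ I, Top E k f I → s * (I ∩ C).card ≤ s * (B ∩ C).card := by
    intro s hs I hI
    obtain ⟨hs1, hs2⟩ := abs_le.mp hs
    set μ : α → ℝ := fun x => if x ∈ C then s else 0 with hμ
    have hsum : ∀ J : Finset α, ∑ x ∈ J, μ x = s * (J ∩ C).card := by
      intro J
      simp only [hμ, Finset.sum_ite_mem, Finset.sum_const, nsmul_eq_mul, mul_comm]
    have := (hf.add_sum μ).le_of_local hB.1 hB.2.1 hI.1 hI.2.1 (by
      intro i hi hiI j hj hjB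
      simp only [sum_exch μ hi hjB]
      have hle := hB.2.2 _ (exch_subset hB.1 (hI.1 hj)) ((card_exch hi hjB).trans hB.2.1)
      by_cases hT : Top E k f (exch B i j)
      · have := hno i hi j (hI.1 hj) hjB hT
        by_cases hiC : i ∈ C <;> by_cases hjC : j ∈ C <;> simp_all
      · have := hgap _ (exch_subset hB.1 (hI.1 hj)) ((card_exch hi hjB).trans hB.2.1) hT
        simp only [hμ]
        split_ifs <;> linarith)
    rw [hsum, hsum, hI.eq_of_top hB] at this
    linarith
  obtain ⟨B₁, B₂, h1, h2, h12⟩ := hc.2 C hC hC0 hCE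
  have heq : ∀ I, Top E k f I → (I ∩ C).card = (B ∩ C).card := by
    intro I hI
    have h1 := main δ (by rw [abs_of_pos hδ]) I hI
    have h2 := main (-δ) (by rw [abs_neg, abs_of_pos hδ]) I hI
    have h3 : ((I ∩ C).card : ℝ) ≤ (B ∩ C).card := le_of_mul_le_mul_left h1 hδ
    have h4 : ((B ∩ C).card : ℝ) ≤ (I ∩ C).card := by
      apply le_of_mul_le_mul_left _ hδ
      linarith
    exact_mod_cast le_antisymm h3 h4
  exact h12 ((heq _ h1).trans (heq _ h2).symm)

lemma Top.erase_iff (hB : Top E k f B) (he : e ∉ B) :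
    Top (E.erase e) k f I ↔ Top E k f I ∧ e ∉ I := by
  have hB' : Top (E.erase e) k f B :=
    ⟨Finset.subset_erase.mpr ⟨hB.1, he⟩, hB.2.1, fun J hJ =>
      hB.2.2 J (hJ.trans (Finset.erase_subset _ _))⟩
  constructor
  · intro h
    obtain ⟨h1, h2⟩ := Finset.subset_erase.mp h.1
    exact ⟨hB.of_eq h1 h.2.1 (h.2.2 B hB'.1 hB'.2.1), h2⟩
  · rintro ⟨h, h2⟩
    exact hB'.of_eq (Finset.subset_erase.mpr ⟨h.1, h2⟩) h.2.1 (h.2.2 B hB.1 hB.2.1)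

lemma Top.contr_iff (hB : Top E (k + 1) f B) (he : e ∈ B) :
    Top (E.erase e) k (contr f e) I ↔ Top E (k + 1) f (insert e I) ∧ e ∉ I := by
  have hins : insert e (B.erase e) = B := Finset.insert_erase he
  have hle : ∀ J ⊆ E.erase e, J.card = k → insert e J ⊆ E ∧ (insert e J).card = k + 1 := by
    intro J hJ hk
    obtain ⟨h1, h2⟩ := Finset.subset_erase.mp hJ
    exact ⟨Finset.insert_subset (hB.1 he) h1, by rw [Finset.card_insert_of_notMem h2, hk]⟩
  have hB' : Top (E.erase e) k (contr f e) (B.erase e) := by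
    refine ⟨Finset.erase_subset_erase _ hB.1, ?_, fun J hJ hk => ?_⟩
    · rw [Finset.card_erase_of_mem he, hB.2.1]; rfl
    · rw [contr, contr, hins]
      exact hB.2.2 _ (hle J hJ hk).1 (hle J hJ hk).2
  constructor
  · intro h
    obtain ⟨h1, h2⟩ := hle I h.1 h.2.1
    refine ⟨hB.of_eq h1 h2 ?_, (Finset.subset_erase.mp h.1).2⟩
    have := h.2.2 _ hB'.1 hB'.2.1
    rwa [contr, contr, hins] at this
  · rintro ⟨h, h2⟩
    refine hB'.of_eq (Finset.subset_erase.mpr ⟨(Finset.subset_insert _ _).trans h.1, h2⟩) ?_ ?_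
    · have := h.2.1
      rw [Finset.card_insert_of_notMem h2] at this
      omega
    · rw [contr, contr, hins]
      exact h.2.2 B hB.1 hB.2.1

lemma sum_indicator (C J : Finset α) :
    ∑ x ∈ J, (if x ∈ C then (1 : ℝ) else 0) = (J ∩ C).card := by
  simp

lemma mem_iff_of_card_exch (hi : i ∈ B) (hj : j ∉ B)
    (h : (exch B i j ∩ C).card = (B ∩ C).card) : i ∈ C ↔ j ∈ C := by
  have := sum_exch (fun x => if x ∈ C then (1 : ℝ) else 0) hi hj
  rw [sum_indicator, sum_indicator, h] at this
  by_cases hiC : i ∈ C <;> by_cases hjC : j ∈ C <;>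
    simp only [hiC, hjC, if_true, if_false] at this ⊢ <;> linarith

lemma Conn.exists_mem (hc : Conn E k f) (hE : 2 ≤ E.card) (he : e ∈ E) :
    (∃ B, Top E k f B ∧ e ∈ B) ∧ ∃ B, Top E k f B ∧ e ∉ B := by
  have hne : ({e} : Finset α) ≠ E := by
    rintro rfl
    simp at hE
  obtain ⟨B, B', hB, hB', h⟩ := hc.2 {e} (by simpa using he) (by simp) hne
  by_cases h1 : e ∈ B <;> by_cases h2 : e ∈ B'
  · simp [h1, h2] at h
  · exact ⟨⟨B, hB, h1⟩, ⟨B', hB', h2⟩⟩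
  · exact ⟨⟨B', hB', h2⟩, ⟨B, hB, h1⟩⟩
  · simp [h1, h2] at h

/-- A disconnected set of maximizers has a constant-cardinality cut through any given point. -/
lemma exists_cut (hB : Top E k f B) (hc : ¬ Conn E k f) (hi : i ∈ E) :
    ∃ C ⊆ E, i ∈ C ∧ C ≠ E ∧
      ∀ B B', Top E k f B → Top E k f B' → (B ∩ C).card = (B' ∩ C).card := by
  rw [Conn, not_and] at hc
  have := hc ⟨B, hB⟩
  push Not at this
  obtain ⟨C, hC, hC0, hCE, hconst⟩ := this
  by_cases hiC : i ∈ C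
  · exact ⟨C, hC, hiC, hCE, hconst⟩
  · refine ⟨E \ C, Finset.sdiff_subset, by simp [hi, hiC], ?_, ?_⟩
    · intro h
      obtain ⟨x, hx⟩ := hC0
      have := hC hx
      rw [← h] at this
      simp [hx] at this
    · intro B₁ B₂ h1 h2
      have hcompl : ∀ B', Top E k f B' → (B' ∩ (E \ C)).card + (B' ∩ C).card = k := by
        intro B' h
        rw [← Finset.inter_sdiff_assoc, Finset.inter_eq_left.mpr h.1,
          Finset.card_sdiff_add_card_inter, h.2.1]
      have := hcompl _ h1
      have := hcompl _ h2
      have := hconst _ _ h1 h2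
      omega

/-- Unordered exchange property of the set of maximizers, from the three-term relation. -/
lemma Generic.top_exch (hf : Generic E k f) (hB : Top E k f B)
    (hi : i ∈ B) (hi' : i' ∈ B) (h : i ≠ i') (hj : j ∈ E) (hjB : j ∉ B) (hj' : j' ∈ E)
    (hjB' : j' ∉ B) (h' : j ≠ j')
    (h1 : Top E k f (exch B i j)) (h2 : Top E k f (exch B i' j')) :
    Top E k f (exch (exch B i j) i' j') ∨
      Top E k f (exch B i j') ∧ Top E k f (exch B i' j) := by
  have e1 := hB.eq_of_top h1
  have e2 := hB.eq_of_top h2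
  have hiE := hB.1 hi
  have hiE' := hB.1 hi'
  have s1 := exch_subset (i := i) hB.1 hj'
  have s2 := exch_subset (i := i') hB.1 hj
  have s3 := exch_subset (i := i') h1.1 hj'
  have c1 := (card_exch hi hjB').trans hB.2.1
  have c2 := (card_exch hi' hjB).trans hB.2.1
  have c3 := (card_exch (B := exch B i j) (i := i') (j := j') (by
    rw [mem_exch]; exact Or.inr ⟨h.symm, hi'⟩) (by
    rw [mem_exch]; rintro (h | h); exacts [h' h.symm, hjB' h.2])).trans h1.2.1
  have l1 := hB.2.2 _ s1 c1
  have l2 := hB.2.2 _ s2 c2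
  have l3 := hB.2.2 _ s3 c3
  have key : f (exch B i j) + f (exch B i' j') ≤
      max (f B + f (exch (exch B i j) i' j')) (f (exch B i j') + f (exch B i' j)) := by
    obtain ⟨S, hS, hSk, hiS, hiS', rfl⟩ := exists_eq_insert_insert hB.1 hB.2.1 hi hi' h
    simp only [Finset.mem_insert, not_or] at hjB hjB'
    have := hf.three_term hS hSk hj hiE' hj' hiE hjB.2.2 hiS' hjB'.2.2 hiS hjB.2.1 h'
      hjB.1 (Ne.symm hjB'.2.1) h.symm hjB'.1
    rw [exch_exch_insert hiS hiS' h (Ne.symm hjB.2.1), exch_insert_left hiS h,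
      exch_insert_left hiS h, exch_insert_right hiS' h, exch_insert_right hiS' h]
    rw [Finset.insert_comm i i', Finset.insert_comm j' i']
    rw [max_comm, add_comm, add_comm (f (insert j (insert j' S)))] at this
    rw [max_comm, add_comm (f (insert i' (insert j' S)))]
    linarith
  rcases le_max_iff.mp key with h | h
  · exact Or.inl (hB.of_eq s3 c3 (by linarith))
  · exact Or.inr ⟨hB.of_eq s1 c1 (by linarith), hB.of_eq s2 c2 (by linarith)⟩

lemma exch_exch_comm (hi' : i' ∈ B) (hi : i ∈ B) (hj : j ∉ B) (hj' : j' ∉ B) :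
    exch (exch B i j) i' j' = exch (exch B i' j') i j := by
  ext x
  simp only [mem_exch]
  grind

lemma exch_exch_swap (hi' : i' ∈ B) (hi : i ∈ B) (hj : j ∉ B) :
    exch (exch B i j) i' j' = exch (exch B i' j) i j' := by
  ext x
  simp only [mem_exch]
  grind

lemma Generic.top_rule (hf : Generic E k f) (hS : S ⊆ E) (hk : S.card + 2 = k)
    (ha : a ∈ E) (hb : b ∈ E) (hc : c ∈ E) (hd : d ∈ E)
    (haS : a ∉ S) (hbS : b ∉ S) (hcS : c ∉ S) (hdS : d ∉ S)
    (hab : a < b) (hbc : b < c) (hcd : c < d) (hT : ∃ B, Top E k f B) :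
    (Top E k f (insert a (insert c S)) ∧ Top E k f (insert b (insert d S)) ↔
      (Top E k f (insert a (insert b S)) ∧ Top E k f (insert c (insert d S))) ∨
      (Top E k f (insert a (insert d S)) ∧ Top E k f (insert b (insert c S)))) ∧
    ¬ ((Top E k f (insert a (insert b S)) ∧ Top E k f (insert c (insert d S))) ∧
      (Top E k f (insert a (insert d S)) ∧ Top E k f (insert b (insert c S)))) := by
  obtain ⟨B, hB⟩ := hT
  have key : ∀ x y, x ∈ E → y ∈ E → x ∉ S → y ∉ S → x ≠ y →
      f (insert x (insert y S)) ≤ f B ∧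
      (Top E k f (insert x (insert y S)) ↔ f (insert x (insert y S)) = f B) := by
    intro x y hx hy hxS hyS hxy
    have h1 : insert x (insert y S) ⊆ E := Finset.insert_subset hx (Finset.insert_subset hy hS)
    have h2 : (insert x (insert y S)).card = k := by
      rw [Finset.card_insert_of_notMem (by simp [hxS, hxy]), Finset.card_insert_of_notMem hyS]
      omega
    exact ⟨hB.2.2 _ h1 h2, fun h => h.eq_of_top hB, fun h => hB.of_eq h1 h2 h.ge⟩
  obtain ⟨h1, h2⟩ := hf S hS hk a ha b hb c hc d hd hab hbc hcd haS hbS hcS hdS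
  have hac := hab.trans hbc
  have hbd := hbc.trans hcd
  have had := hac.trans hcd
  obtain ⟨l1, t1⟩ := key a b ha hb haS hbS hab.ne
  obtain ⟨l2, t2⟩ := key a c ha hc haS hcS hac.ne
  obtain ⟨l3, t3⟩ := key a d ha hd haS hdS had.ne
  obtain ⟨l4, t4⟩ := key b c hb hc hbS hcS hbc.ne
  obtain ⟨l5, t5⟩ := key b d hb hd hbS hdS hbd.ne
  obtain ⟨l6, t6⟩ := key c d hc hd hcS hdS hcd.ne
  rw [t1, t2, t3, t4, t5, t6]
  constructor
  · constructor
    · rintro ⟨h3, h4⟩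
      rcases max_cases (f (insert a (insert b S)) + f (insert c (insert d S)))
        (f (insert a (insert d S)) + f (insert b (insert c S))) with h | h
      · exact Or.inl ⟨by linarith, by linarith⟩
      · exact Or.inr ⟨by linarith, by linarith⟩
    · rintro (⟨h3, h4⟩ | ⟨h3, h4⟩)
      · have := le_max_left (f (insert a (insert b S)) + f (insert c (insert d S)))
          (f (insert a (insert d S)) + f (insert b (insert c S)))
        exact ⟨by linarith, by linarith⟩
      · have := le_max_right (f (insert a (insert b S)) + f (insert c (insert d S)))
          (f (insert a (insert d S)) + f (insert b (insert c S)))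
        exact ⟨by linarith, by linarith⟩
  · rintro ⟨⟨h3, h4⟩, h5, h6⟩
    exact h2 (by linarith)

/-- Exchanges at a maximizer `B`, with the two leaving elements below the two entering ones. -/
lemma Generic.rule_lt (hf : Generic E k f) (hB : Top E k f B)
    (hi : i ∈ B) (hi' : i' ∈ B) (hj : j ∈ E) (hjB : j ∉ B) (hj' : j' ∈ E) (hjB' : j' ∉ B)
    (h1 : i < i') (h2 : i' < j) (h3 : j < j') :
    (Top E k f (exch B i' j) ∧ Top E k f (exch B i j') ↔
      Top E k f (exch (exch B i j) i' j') ∨ Top E k f (exch B i j) ∧ Top E k f (exch B i' j')) ∧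
    ¬ (Top E k f (exch (exch B i j) i' j') ∧
      Top E k f (exch B i j) ∧ Top E k f (exch B i' j')) := by
  have hiE := hB.1 hi
  have hiE' := hB.1 hi'
  obtain ⟨S, hS, hSk, hiS, hiS', rfl⟩ := exists_eq_insert_insert hB.1 hB.2.1 hi hi' h1.ne
  simp only [Finset.mem_insert, not_or] at hjB hjB'
  have := hf.top_rule hS hSk hiE hiE' hj hj' hiS hiS' hjB.2.2 hjB'.2.2 h1 h2 h3 ⟨_, hB⟩
  rw [exch_exch_insert hiS hiS' h1.ne h2.ne, exch_insert_left hiS h1.ne,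
    exch_insert_left hiS h1.ne, exch_insert_right hiS' h1.ne, exch_insert_right hiS' h1.ne]
  rw [Finset.insert_comm i j, Finset.insert_comm i' j', Finset.insert_comm i j',
    Finset.insert_comm i' j] at this
  tauto

/-- Exchanges at a maximizer `B`, with the two leaving elements between the two entering ones. -/
lemma Generic.rule_between (hf : Generic E k f) (hB : Top E k f B)
    (hi : i ∈ B) (hi' : i' ∈ B) (hj : j ∈ E) (hjB : j ∉ B) (hj' : j' ∈ E) (hjB' : j' ∉ B)
    (h1 : j < i) (h2 : i < i') (h3 : i' < j') (hD : Top E k f (exch (exch B i j) i' j')) :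
    Top E k f (exch B i j) := by
  have hiE := hB.1 hi
  have hiE' := hB.1 hi'
  obtain ⟨S, hS, hSk, hiS, hiS', rfl⟩ := exists_eq_insert_insert hB.1 hB.2.1 hi hi' h2.ne
  simp only [Finset.mem_insert, not_or] at hjB hjB'
  have := hf.top_rule hS hSk hj hiE hiE' hj' hjB.2.2 hiS hiS' hjB'.2.2 h1 h2 h3 ⟨_, hB⟩
  rw [exch_exch_insert hiS hiS' h2.ne (h1.trans h2).ne'] at hD
  rw [exch_insert_left hiS h2.ne]
  tauto

/-- Exchanges at a maximizer `B`, with leaving and entering elements alternating. -/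
lemma Generic.rule_alt (hf : Generic E k f) (hB : Top E k f B)
    (hi : i ∈ B) (hi' : i' ∈ B) (hj : j ∈ E) (hjB : j ∉ B) (hj' : j' ∈ E) (hjB' : j' ∉ B)
    (h1 : i < j) (h2 : j < i') (h3 : i' < j') (hD : Top E k f (exch (exch B i j) i' j')) :
    Top E k f (exch B i' j) ∨ Top E k f (exch B i j) := by
  have hiE := hB.1 hi
  have hiE' := hB.1 hi'
  have h := h1.trans h2
  obtain ⟨S, hS, hSk, hiS, hiS', rfl⟩ := exists_eq_insert_insert hB.1 hB.2.1 hi hi' h.ne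
  simp only [Finset.mem_insert, not_or] at hjB hjB'
  have := hf.top_rule hS hSk hiE hj hiE' hj' hiS hjB.2.2 hiS' hjB'.2.2 h1 h2 h3 ⟨_, hB⟩
  rw [exch_exch_insert hiS hiS' h.ne h2.ne'] at hD
  rw [exch_insert_left hiS h.ne, exch_insert_right hiS' h.ne, Finset.insert_comm j i]
  tauto

lemma exch_comm_erase :
    exch (exch B b e) i j = insert e (exch (B.erase b) i j) ∨ i = e := by
  by_cases hi : i = e
  · exact Or.inr hi
  · left
    ext x
    simp only [mem_exch, Finset.mem_insert, Finset.mem_erase]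
    grind

lemma exch_erase_self (h : i ≠ b) (hb : b ∈ B) : exch (B.erase b) i b = B.erase i := by
  ext x
  simp only [mem_exch, Finset.mem_erase]
  grind

lemma Generic.conn_erase_or_conn_contr (hf : Generic E (k + 1) f) (hc : Conn E (k + 1) f)
    (hE : 2 ≤ E.card) (he : e ∈ E) :
    Conn (E.erase e) (k + 1) f ∨ Conn (E.erase e) k (PosTrop.contr f e) := by
  by_contra! hno
  obtain ⟨h1, h2⟩ := hno
  obtain ⟨B, hB, heB⟩ := (hc.exists_mem hE he).2
  have hne : ({e} : Finset α) ≠ E := by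
    rintro rfl
    simp at hE
  obtain ⟨m, hm, j, -, -, hme, hij⟩ := hc.exists_exch hf hB (by simpa using he) (by simp) hne
  have hmne : m ≠ e := by rintro rfl; exact heB hm
  obtain rfl : j = e := by simpa [hmne] using hij
  clear hij hne
  rename' j => e
  have hB1 := (hB.erase_iff heB).2 ⟨hB, heB⟩
  have hmE : m ∈ E.erase e := Finset.mem_erase.mpr ⟨hmne, hB.1 hm⟩
  obtain ⟨C₁, hC₁, hmC₁, hC₁E, hconst₁⟩ := exists_cut hB1 h1 hmE
  have hcontr : ∀ I, Top (E.erase e) k (PosTrop.contr f e) I ↔ Top E (k + 1) f (insert e I) ∧ e ∉ I :=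
    fun I => hme.contr_iff (by simp [mem_exch])
  have hB2 : Top (E.erase e) k (PosTrop.contr f e) (B.erase m) :=
    (hcontr _).2 ⟨hme, by simp [heB]⟩
  obtain ⟨C₂, hC₂, hmC₂, hC₂E, hconst₂⟩ := exists_cut hB2 h2 hmE
  have edge₁ : ∀ i ∈ B, ∀ j, j ∉ B → j ≠ e → Top E (k + 1) f (exch B i j) →
      (i ∈ C₁ ↔ j ∈ C₁) := by
    intro i hi j hj hje hT
    refine mem_iff_of_card_exch hi hj (hconst₁ _ _ ((hB.erase_iff heB).2 ⟨hT, ?_⟩) hB1)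
    simp [mem_exch, heB, hje.symm]
  have edgeN : ∀ i ∈ B, Top E (k + 1) f (exch B i e) → i ∈ C₂ := by
    intro i hi hT
    by_cases him : i = m
    · rwa [him]
    refine (mem_iff_of_card_exch (B := B.erase m) (j := m) (Finset.mem_erase.mpr ⟨him, hi⟩) (by simp)
      (hconst₂ _ _ ((hcontr _).2 ?_) hB2)).2 hmC₂
    rw [exch_erase_self him hm]
    exact ⟨hT, by simp [heB]⟩
  have edgeD : ∀ i ∈ B, i ≠ m → ∀ j, j ∉ B → j ≠ e →
      Top E (k + 1) f (exch (exch B m e) i j) → (i ∈ C₂ ↔ j ∈ C₂) := by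
    intro i hi him j hj hje hT
    have hie : i ≠ e := by rintro rfl; exact heB hi
    refine mem_iff_of_card_exch (B := B.erase m) (Finset.mem_erase.mpr ⟨him, hi⟩) (by simp [hj])
      (hconst₂ _ _ ((hcontr _).2 ?_) hB2)
    rw [(exch_comm_erase).resolve_right hie] at hT
    exact ⟨hT, by simp [mem_exch, heB, hje.symm]⟩
  have cross : ∀ C ⊆ E.erase e, C ≠ E.erase e →
      ∃ i ∈ B, ∃ j ∈ E, j ∉ B ∧ Top E (k + 1) f (exch B i j) ∧
        (j = e ∧ i ∉ C ∨ j ≠ e ∧ (i ∈ C ↔ j ∉ C)) := by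
    intro C hC hCE
    have heC : e ∉ C := fun h => by simpa using hC h
    obtain ⟨i, hi, j, hj, hjB, hT, hij⟩ := hc.exists_exch hf hB (C := insert e C)
      (Finset.insert_subset he (hC.trans (Finset.erase_subset _ _))) (by simp)
      (by rintro rfl; simp [heC] at hCE)
    have hie : i ≠ e := by rintro rfl; exact heB hi
    refine ⟨i, hi, j, hj, hjB, hT, ?_⟩
    simp only [Finset.mem_insert, hie, false_or, not_or] at hij
    by_cases hje : j = e <;> simp_all
  by_cases hN : ∀ i ∈ B, Top E (k + 1) f (exch B i e) → i ∈ C₁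
  · obtain ⟨i, hi, j, hj, hjB, hT, ⟨rfl, h⟩ | ⟨hje, h⟩⟩ := cross C₁ hC₁ hC₁E
    · exact h (hN i hi hT)
    · have := edge₁ i hi j hjB hje hT
      tauto
  · push Not at hN
    obtain ⟨n, hn, hne, hnC⟩ := hN
    have hnm : n ≠ m := by rintro rfl; exact hnC hmC₁
    have hnC₂ := edgeN n hn hne
    have hNm : ∀ j ∈ E, j ∉ B → j ≠ e → Top E (k + 1) f (exch B m j) → j ∈ C₂ := by
      intro j hj hjB hje hT
      have hjC : j ∈ C₁ := (edge₁ m hm j hjB hje hT).1 hmC₁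
      rcases hf.top_exch hB hm hn hnm.symm hj hjB he heB hje hT hne with h | h
      · rw [exch_exch_swap hn hm hjB, exch_exch_comm hm hn hjB heB] at h
        exact (edgeD n hn hnm j hjB hje h).1 hnC₂
      · exact absurd ((edge₁ n hn j hjB hje h.2).2 hjC) hnC
    obtain ⟨i, hi, j, hj, hjB, hT, ⟨rfl, h⟩ | ⟨hje, h⟩⟩ := cross C₂ hC₂ hC₂E
    · exact h (edgeN i hi hT)
    · by_cases him : i = m
      · subst him
        exact (h.1 hmC₂) (hNm j hj hjB hje hT)
      · rcases hf.top_exch hB hm hi (Ne.symm him) he heB hj hjB hje.symm hme hT with h' | h'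
        · have := edgeD i hi him j hjB hje h'
          tauto
        · exact (h.1 (edgeN i hi h'.2)) (hNm j hj hjB hje h'.1)

lemma conn_of_conn_erase_or_conn_contr {B' : Finset α} (he : e ∈ E) (hB : Top E (k + 1) f B)
    (heB : e ∉ B) (hB' : Top E (k + 1) f B') (heB' : e ∈ B')
    (h : Conn (E.erase e) (k + 1) f ∨ Conn (E.erase e) k (contr f e)) : Conn E (k + 1) f := by
  refine ⟨⟨B, hB⟩, fun C hC hC0 hCE => ?_⟩
  by_cases h0 : C.erase e = ∅
  · have heC : C = {e} := by
      rcases (Finset.erase_eq_empty_iff _ _).mp h0 with h | h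
      · exact absurd h hC0.ne_empty
      · exact h
    subst heC
    exact ⟨B, B', hB, hB', by simp [heB, heB']⟩
  by_cases h1 : C.erase e = E.erase e
  · have heC : e ∉ C := fun h => hCE (by
      rw [← Finset.insert_erase h, h1, Finset.insert_erase he])
    rw [Finset.erase_eq_of_notMem heC] at h1
    refine ⟨B, B', hB, hB', ?_⟩
    rw [h1, Finset.inter_eq_left.mpr (Finset.subset_erase.mpr ⟨hB.1, heB⟩), Finset.inter_erase,
      Finset.inter_eq_left.mpr hB'.1, Finset.card_erase_of_mem heB', hB.2.1, hB'.2.1]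
    omega
  rcases h with h | h
  · obtain ⟨B₁, B₂, h3, h4, h5⟩ := h.2 _ (Finset.erase_subset_erase _ hC)
      (Finset.nonempty_iff_ne_empty.mpr h0) h1
    rw [hB.erase_iff heB] at h3 h4
    refine ⟨B₁, B₂, h3.1, h4.1, ?_⟩
    rwa [Finset.inter_erase, Finset.inter_erase, Finset.erase_eq_of_notMem (by simp [h3.2]),
      Finset.erase_eq_of_notMem (by simp [h4.2])] at h5
  · obtain ⟨B₁, B₂, h3, h4, h5⟩ := h.2 _ (Finset.erase_subset_erase _ hC)
      (Finset.nonempty_iff_ne_empty.mpr h0) h1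
    rw [hB'.contr_iff heB'] at h3 h4
    refine ⟨_, _, h3.1, h4.1, ?_⟩
    rw [Finset.inter_erase, Finset.inter_erase, Finset.erase_eq_of_notMem (by simp [h3.2]),
      Finset.erase_eq_of_notMem (by simp [h4.2])] at h5
    by_cases heC : e ∈ C
    · rw [Finset.insert_inter_of_mem heC, Finset.insert_inter_of_mem heC,
        Finset.card_insert_of_notMem (by simp [h3.2]), Finset.card_insert_of_notMem (by simp [h4.2])]
      omega
    · rwa [Finset.insert_inter_of_notMem heC, Finset.insert_inter_of_notMem heC]

/-- Exchanges along the contraction of `e` at the maximizer obtained from `B` by exchanging `m`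
for `e`. -/
lemma Conn.exists_exch_contr {m : α} (hf : Generic E (k + 1) f)
    (hc : Conn (E.erase e) k (contr f e)) (heB : e ∉ B) (hm : m ∈ B)
    (hme : Top E (k + 1) f (exch B m e)) (hC : C ⊆ E.erase e) (hC0 : C.Nonempty)
    (hCE : C ≠ E.erase e) :
    ∃ i ∈ B, i ≠ m ∧ ((Top E (k + 1) f (exch B i e) ∧ (i ∈ C ↔ m ∉ C)) ∨
      ∃ j ∈ E, j ∉ B ∧ j ≠ e ∧ Top E (k + 1) f (exch (exch B i e) m j) ∧ (i ∈ C ↔ j ∉ C)) := by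
  have he : e ∈ E := hme.1 (by simp [mem_exch])
  have hcontr : ∀ I, Top (E.erase e) k (PosTrop.contr f e) I ↔
      Top E (k + 1) f (insert e I) ∧ e ∉ I := fun I => hme.contr_iff (by simp [mem_exch])
  have hB2 : Top (E.erase e) k (PosTrop.contr f e) (B.erase m) :=
    (hcontr _).2 ⟨hme, by simp [heB]⟩
  obtain ⟨i, hi, j, hj, hjB, hT, hij⟩ := hc.exists_exch (hf.contr he) hB2 hC hC0 hCE
  rw [hcontr] at hT
  rw [Finset.mem_erase] at hi hj
  have hie : i ≠ e := by rintro rfl; exact heB hi.2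
  refine ⟨i, hi.2, hi.1, ?_⟩
  by_cases hjm : j = m
  · subst hjm
    rw [exch_erase_self hi.1 hm] at hT
    exact Or.inl ⟨hT.1, hij⟩
  · have hjB' : j ∉ B := fun h => hjB (Finset.mem_erase.mpr ⟨hjm, h⟩)
    refine Or.inr ⟨j, hj.2, hjB', hj.1, ?_, hij⟩
    rw [exch_exch_swap hm hi.2 heB,
      exch_comm_erase.resolve_right hie]
    exact hT.1

/-- A lexicographically minimal maximizer: all exchanges go up. -/
lemma exists_top_lt (h : ∃ B, Top E k f B) :
    ∃ B, Top E k f B ∧ ∀ i ∈ B, ∀ j ∈ E, j ∉ B → Top E k f (exch B i j) → i < j := by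
  classical
  obtain ⟨B₀, hB₀⟩ := h
  set rk : α → ℝ := fun x => ((E.filter (· < x)).card : ℝ) with hrk
  obtain ⟨B, hB, hmin⟩ := Finset.exists_min_image ((E.powersetCard k).filter (Top E k f))
    (fun I => ∑ x ∈ I, rk x) ⟨B₀, by simp [hB₀, hB₀.1, hB₀.2.1]⟩
  simp only [Finset.mem_filter, Finset.mem_powersetCard] at hB hmin
  refine ⟨B, hB.2, fun i hi j hj hjB hT => ?_⟩
  have h1 := hmin _ ⟨⟨hT.1, hT.2.1⟩, hT⟩
  rw [sum_exch rk hi hjB] at h1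
  by_contra! hij
  have hlt : j < i := lt_of_le_of_ne hij (by rintro rfl; exact hjB hi)
  have : rk j < rk i := by
    simp only [hrk, Nat.cast_lt]
    apply Finset.card_lt_card
    refine ⟨fun x hx => ?_, fun h => ?_⟩
    · rw [Finset.mem_filter] at hx ⊢
      exact ⟨hx.1, hx.2.trans hlt⟩
    · have := h (Finset.mem_filter.mpr ⟨hj, hlt⟩)
      simp at this
  linarith

/-- For a connected set of maximizers on at least three elements, some deletion or some
contraction is disconnected. -/
lemma Conn.exists_not_conn (hf : Generic E (k + 1) f) (hc : Conn E (k + 1) f) (hE : 3 ≤ E.card)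
    (h1 : ∀ e ∈ E, Conn (E.erase e) (k + 1) f) (h2 : ∀ e ∈ E, Conn (E.erase e) k (contr f e)) :
    False := by
  obtain ⟨B, hB, hlt⟩ := exists_top_lt hc.1
  have hBne : B.Nonempty := by
    rw [← Finset.card_pos, hB.2.1]
    omega
  obtain ⟨m, hm, hmax⟩ : ∃ m ∈ B, ∀ x ∈ B, x ≤ m := Finset.exists_max_image B id hBne
  have hsing : ∀ x : α, ({x} : Finset α) ≠ E := by
    rintro x rfl
    simp at hE
  obtain ⟨j₁, hj₁, hj₁B, hmj₁⟩ : ∃ j ∈ E, j ∉ B ∧ Top E (k + 1) f (exch B m j) := by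
    obtain ⟨i, hi, j, hj, hjB, hT, hij⟩ :=
      hc.exists_exch hf hB (C := {m}) (by simpa using hB.1 hm) (by simp) (hsing m)
    have : j ≠ m := by rintro rfl; exact hjB hm
    obtain rfl : i = m := by simpa [this] using hij
    exact ⟨j, hj, hjB, hT⟩
  have hmj₁' := hlt m hm j₁ hj₁ hj₁B hmj₁
  obtain ⟨e, he, hmin⟩ : ∃ e ∈ E.filter (m < ·), ∀ x ∈ E.filter (m < ·), e ≤ x :=
    Finset.exists_min_image (E.filter (m < ·)) id ⟨j₁, by simp [hj₁, hmj₁']⟩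
  simp only [Finset.mem_filter, and_imp] at he hmin
  obtain ⟨he, hm_lt⟩ := he
  have hnotMem : ∀ x, m < x → x ∉ B := fun x hx hxB => (hmax x hxB).not_gt hx
  have heB := hnotMem e hm_lt
  have hme : Top E (k + 1) f (exch B m e) := by
    obtain ⟨i, hi, j, hj, hjB, hT, hij⟩ :=
      hc.exists_exch hf hB (C := {e}) (by simpa using he) (by simp) (hsing e)
    have : i ≠ e := by rintro rfl; exact heB hi
    obtain rfl : j = e := by simpa [this] using hij
    rcases (hmax i hi).eq_or_lt with rfl | him
    · exact hT
    · rcases (hmin j₁ hj₁ hmj₁').eq_or_lt with h | h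
      · rwa [h]
      · exact ((hf.rule_lt hB hi hm hj hjB hj₁ hj₁B him hm_lt h).1.2 (Or.inr ⟨hT, hmj₁⟩)).1
  obtain ⟨j₂, hj₂, hej₂, hmj₂⟩ : ∃ j ∈ E, e < j ∧ Top E (k + 1) f (exch B m j) := by
    obtain ⟨i, hi, j, hj, hjB, hT, hij⟩ := (h1 e he).exists_exch (C := {m}) (hf.erase e)
      ((hB.erase_iff heB).2 ⟨hB, heB⟩) (by simpa using ⟨hm_lt.ne, hB.1 hm⟩) (by simp) (by
        intro h
        have := Finset.card_erase_of_mem he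
        rw [← h, Finset.card_singleton] at this
        omega)
    have hjm : j ≠ m := by rintro rfl; exact hjB hm
    obtain rfl : i = m := by simpa [hjm] using hij
    rw [Finset.mem_erase] at hj
    rw [hB.erase_iff heB] at hT
    exact ⟨j, hj.2, lt_of_le_of_ne (hmin j hj.2 (hlt i hi j hj.2 hjB hT.1)) hj.1.symm, hT.1⟩
  have hmj₂' := hm_lt.trans hej₂
  have hj₂B := hnotMem j₂ hmj₂'
  have rule : ∀ i ∈ B, i < m → ∀ j ∈ E, e < j →
      (Top E (k + 1) f (exch B i j) ↔ Top E (k + 1) f (exch (exch B i e) m j) ∨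
        Top E (k + 1) f (exch B i e) ∧ Top E (k + 1) f (exch B m j)) ∧
      ¬ (Top E (k + 1) f (exch (exch B i e) m j) ∧ Top E (k + 1) f (exch B i e) ∧
        Top E (k + 1) f (exch B m j)) := by
    intro i hi him j hj hej
    simpa only [hme, true_and] using
      hf.rule_lt hB hi hm he heB hj (hnotMem j (hm_lt.trans hej)) him hm_lt hej
  obtain ⟨i₁, hi₁, hi₁m, hi₁j₂, hi₁e⟩ : ∃ i ∈ B, i < m ∧ Top E (k + 1) f (exch B i j₂) ∧
      ¬ Top E (k + 1) f (exch B i e) := by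
    obtain ⟨i, hi, him, h⟩ := (h2 e he).exists_exch_contr hf heB hm hme (C := {j₂})
      (by simpa using ⟨hej₂.ne', hj₂⟩) (by simp) (by
        intro h
        have : m ∈ E.erase e := Finset.mem_erase.mpr ⟨hm_lt.ne, hB.1 hm⟩
        rw [← h, Finset.mem_singleton] at this
        exact hmj₂'.ne this)
    have hij : i ≠ j₂ := by rintro rfl; exact hj₂B hi
    have him' := lt_of_le_of_ne (hmax i hi) him
    rcases h with ⟨-, h⟩ | ⟨j, hj, hjB, hje, hT, h⟩
    · simp [hij, hmj₂'.ne] at h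
    · obtain rfl : j = j₂ := by simpa [hij] using h
      have := rule i hi him' j hj hej₂
      exact ⟨i, hi, him', this.1.2 (Or.inl hT), fun h => this.2 ⟨hT, h, hmj₂⟩⟩
  have claim : ∀ i ∈ B, i < m → ∀ j ∈ E, e < j → Top E (k + 1) f (exch B i e) →
      Top E (k + 1) f (exch B i j) → Top E (k + 1) f (exch B m j) := by
    intro i hi him j hj hej hie hij
    by_contra hmj
    have hmj' := hm_lt.trans hej
    have hjB := hnotMem j hmj'
    have hlt₂ : j₂ < j := by
      rcases lt_trichotomy j j₂ with h | rfl | h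
      · exact absurd ((hf.rule_lt hB hi hm hj hjB hj₂ hj₂B him hmj' h).1.2
          (Or.inr ⟨hij, hmj₂⟩)).1 hmj
      · exact absurd hmj₂ hmj
      · exact h
    have hlt₁ : i₁ < i := by
      rcases lt_trichotomy i i₁ with h | rfl | h
      · exact absurd ((hf.rule_lt hB hi hi₁ he heB hj₂ hj₂B h (hi₁m.trans hm_lt) hej₂).1.2
          (Or.inr ⟨hie, hi₁j₂⟩)).1 hi₁e
      · exact absurd hie hi₁e
      · exact h
    have r1 := hf.rule_lt hB hi₁ hi he heB hj₂ hj₂B hlt₁ (him.trans hm_lt) hej₂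
    rw [exch_exch_swap hi hi₁ heB] at r1
    have r2 := rule i hi him j hj hej
    have r3 := rule i hi him j₂ hj₂ hej₂
    have hmem : ∀ x, x ∈ exch B i e ↔ x = e ∨ x ≠ i ∧ x ∈ B := fun x => mem_exch
    have r4 := hf.rule_lt hie (i := i₁) (i' := m) (j := j₂) (j' := j)
      ((hmem _).2 (Or.inr ⟨hlt₁.ne, hi₁⟩)) ((hmem _).2 (Or.inr ⟨him.ne', hm⟩)) hj₂
      (by simp [hmem, hej₂.ne', hj₂B]) hj (by simp [hmem, hej.ne', hjB]) hi₁m hmj₂' hlt₂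
    have t1 := (r1.1.1 ⟨hie, hi₁j₂⟩).resolve_right fun h => hi₁e h.1
    have t2 := (r2.1.1 hij).resolve_right fun h => hmj h.2
    exact r3.2 ⟨(r4.1.2 (Or.inr ⟨t1, t2⟩)).1, hie, hmj₂⟩
  obtain ⟨p, hp, hpe, hpmin⟩ : ∃ p ∈ B, Top E (k + 1) f (exch B p e) ∧
      ∀ x ∈ B, Top E (k + 1) f (exch B x e) → p ≤ x := by
    classical
    obtain ⟨p, hp, hpmin⟩ := Finset.exists_min_image
      (B.filter fun i => Top E (k + 1) f (exch B i e)) id ⟨m, by simp [hm, hme]⟩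
    simp only [Finset.mem_filter, and_imp, id_eq] at hp hpmin
    exact ⟨p, hp.1, hp.2, hpmin⟩
  have hpm := hmax p hp
  have hA : ∀ x, x ∈ E.filter (fun x => p ≤ x ∧ x ≤ m) ↔ x ∈ E ∧ p ≤ x ∧ x ≤ m := fun x => by
    simp
  obtain ⟨i, hi, him, h⟩ := (h2 e he).exists_exch_contr hf heB hm hme
    (C := E.filter (fun x => p ≤ x ∧ x ≤ m))
    (fun x hx => Finset.mem_erase.mpr ⟨fun h => by
      rw [hA, h] at hx
      exact hx.2.2.not_gt hm_lt, ((hA x).1 hx).1⟩) ⟨m, (hA m).2 ⟨hB.1 hm, hpm, le_rfl⟩⟩ (by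
      intro h
      have : j₂ ∈ E.erase e := Finset.mem_erase.mpr ⟨hej₂.ne', hj₂⟩
      rw [← h, hA] at this
      exact this.2.2.not_gt hmj₂')
  replace him := lt_of_le_of_ne (hmax i hi) him
  simp only [hA, hB.1 hi, hB.1 hm, true_and, him.le, hpm, le_refl, and_true] at h
  rcases h with ⟨hie, h⟩ | ⟨j, hj, hjB, hje, hD, h⟩
  · exact absurd (hpmin i hi hie) (by simpa using h)
  have hD' : Top E (k + 1) f (exch (exch B i j) m e) := by
    rw [exch_exch_swap hm hi hjB, exch_exch_comm hi hm hjB heB]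
    exact hD
  simp only [hj, true_and] at h
  by_cases hpi : p ≤ i
  · simp only [hpi, true_iff, not_and, not_le] at h
    rcases lt_or_ge j p with hjp | hjp
    · have hji := hjp.trans_le hpi
      exact (hlt i hi j hj hjB (hf.rule_between hB hi hm hj hjB he heB hji him hm_lt hD')).not_gt
        hji
    · have hej := lt_of_le_of_ne (hmin j hj (h hjp)) hje.symm
      have r := rule i hi him j hj hej
      by_cases hie : Top E (k + 1) f (exch B i e)
      · exact r.2 ⟨hD, hie, claim i hi him j hj hej hie (r.1.2 (Or.inl hD))⟩
      · have hpi' := lt_of_le_of_ne hpi (by rintro rfl; exact hie hpe)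
        exact hie ((hf.rule_lt hB hp hi he heB hj hjB hpi' (him.trans hm_lt) hej).1.2
          (Or.inr ⟨hpe, r.1.2 (Or.inl hD)⟩)).1
  · have hj' : p ≤ j ∧ j ≤ m := not_not.mp fun h' => hpi (h.2 h')
    rw [not_le] at hpi
    have hpj := lt_of_le_of_ne hj'.1 (by rintro rfl; exact hjB hp)
    have hjm := lt_of_le_of_ne hj'.2 (by rintro rfl; exact hjB hm)
    rcases hf.rule_alt hB hi hm hj hjB he heB (hpi.trans hpj) hjm hm_lt hD' with h' | h'
    · exact (hlt m hm j hj hjB h').not_gt hjm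
    · exact (hpmin i hi ((hf.rule_lt hB hi hp hj hjB he heB hpi hpj (hjm.trans hm_lt)).1.2
        (Or.inr ⟨h', hpe⟩)).2).not_gt hpi

lemma top_congr {g : Finset α → ℝ} (t : ℝ) (h : ∀ I ⊆ E, I.card = k → g I = f I + t) :
    Top E k g I ↔ Top E k f I := by
  constructor
  · rintro ⟨h1, h2, h3⟩
    refine ⟨h1, h2, fun J hJ hJk => ?_⟩
    have := h3 J hJ hJk
    rw [h I h1 h2, h J hJ hJk] at this
    linarith
  · rintro ⟨h1, h2, h3⟩
    refine ⟨h1, h2, fun J hJ hJk => ?_⟩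
    rw [h I h1 h2, h J hJ hJk]
    linarith [h3 J hJ hJk]

lemma conn_congr {g : Finset α → ℝ} (h : ∀ I, Top E k g I ↔ Top E k f I) :
    Conn E k g ↔ Conn E k f := by
  simp only [Conn, h]

lemma sum_single (e : α) (t : ℝ) (I : Finset α) :
    ∑ x ∈ I, (if x = e then t else 0) = if e ∈ I then t else 0 := by
  simp

lemma top_erase_add_sum (e : α) (t : ℝ) :
    Top (E.erase e) k (fun J => f J + ∑ x ∈ J, if x = e then t else 0) I ↔
      Top (E.erase e) k f I := by
  refine top_congr 0 fun J hJ _ => ?_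
  simp [(Finset.subset_erase.mp hJ).2]

lemma top_contr_add_sum (e : α) (t : ℝ) :
    Top (E.erase e) k (contr (fun J => f J + ∑ x ∈ J, if x = e then t else 0) e) I ↔
      Top (E.erase e) k (contr f e) I := by
  refine top_congr t fun J _ _ => ?_
  simp [contr]

/-- Changing the weight of `e` makes deletion and contraction appear simultaneously. -/
lemma exists_equalize (he : e ∈ E) (h0 : ∃ B, Top (E.erase e) (k + 1) f B)
    (h1 : ∃ B, Top (E.erase e) k (contr f e) B) :
    ∃ t : ℝ, (∃ B, Top E (k + 1) (fun J => f J + ∑ x ∈ J, if x = e then t else 0) B ∧ e ∉ B) ∧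
      ∃ B, Top E (k + 1) (fun J => f J + ∑ x ∈ J, if x = e then t else 0) B ∧ e ∈ B := by
  obtain ⟨B₀, hB₀⟩ := h0
  obtain ⟨B₁, hB₁⟩ := h1
  obtain ⟨h01, h02⟩ := Finset.subset_erase.mp hB₀.1
  obtain ⟨h11, h12⟩ := Finset.subset_erase.mp hB₁.1
  refine ⟨f B₀ - f (insert e B₁), ?_⟩
  simp only [sum_single]
  have hle : ∀ J ⊆ E, J.card = k + 1 →
      f J + (if e ∈ J then f B₀ - f (insert e B₁) else 0) ≤ f B₀ := by
    intro J hJ hJk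
    split_ifs with heJ
    · have := hB₁.2.2 (J.erase e) (Finset.erase_subset_erase _ hJ)
        (by rw [Finset.card_erase_of_mem heJ, hJk]; rfl)
      rw [contr, contr, Finset.insert_erase heJ] at this
      linarith
    · rw [add_zero]
      exact hB₀.2.2 J (Finset.subset_erase.mpr ⟨hJ, heJ⟩) hJk
  refine ⟨⟨B₀, ⟨h01, hB₀.2.1, ?_⟩, h02⟩, insert e B₁, ⟨Finset.insert_subset he h11, ?_, ?_⟩,
    Finset.mem_insert_self _ _⟩
  · simpa [h02] using hle
  · rw [Finset.card_insert_of_notMem h12, hB₁.2.1]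
  · simpa using hle

lemma Conn.eq_one_of_card_two (hc : Conn E k f) (hE : E.card = 2) : k = 1 := by
  obtain ⟨e, he⟩ : E.Nonempty := Finset.card_pos.mp (by omega)
  obtain ⟨⟨B, hB, heB⟩, B', hB', heB'⟩ := hc.exists_mem hE.ge he
  have h1 := Finset.card_pos.mpr ⟨e, heB⟩
  have h2 := Finset.card_lt_card (Finset.ssubset_iff_subset_ne.mpr
    ⟨hB'.1, by rintro rfl; exact heB' he⟩)
  have := hB.2.1
  have := hB'.2.1
  omega

/-- Deletion and contraction of the same element cannot both be connected. -/
lemma Generic.not_conn_erase_and_conn_contr (hf : Generic E (k + 1) f) (hE : 3 ≤ E.card)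
    (he : e ∈ E) (h1 : Conn (E.erase e) (k + 1) f) (h2 : Conn (E.erase e) k (PosTrop.contr f e)) :
    False := by
  induction hn : E.card using Nat.strong_induction_on generalizing E k f with
  | _ n ih =>
  have hcard := Finset.card_erase_of_mem he
  obtain ⟨t, ht⟩ := exists_equalize he h1.1 h2.1
  rw [← conn_congr fun _ => top_erase_add_sum e t] at h1
  rw [← conn_congr fun _ => top_contr_add_sum e t] at h2
  replace hf := hf.add_sum (fun x => if x = e then t else 0)
  revert ht h1 h2 hf
  generalize (fun J => f J + ∑ x ∈ J, if x = e then t else 0) = g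
  rintro h2 h1 ⟨⟨B₀, hB₀, heB₀⟩, B₁, hB₁, heB₁⟩ hg
  have hc := conn_of_conn_erase_or_conn_contr he hB₀ heB₀ hB₁ heB₁ (Or.inl h1)
  by_cases h3 : E.card = 3
  · have := h1.eq_one_of_card_two (by omega)
    have := h2.eq_one_of_card_two (by omega)
    omega
  have key : ∀ x ∈ E, x ≠ e →
      Conn (E.erase x) (k + 1) g ∧ Conn (E.erase x) k (PosTrop.contr g x) := by
    intro x hx hxe
    have hx' : x ∈ E.erase e := Finset.mem_erase.mpr ⟨hxe, hx⟩
    have he' : e ∈ E.erase x := Finset.mem_erase.mpr ⟨hxe.symm, he⟩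
    have hcardx := Finset.card_erase_of_mem hx
    obtain ⟨⟨T₁, hT₁, hxT₁⟩, T₂, hT₂, hxT₂⟩ := h1.exists_mem (by omega) hx'
    obtain ⟨⟨T₃, hT₃, hxT₃⟩, T₄, hT₄, hxT₄⟩ := h2.exists_mem (by omega) hx'
    obtain ⟨k, rfl⟩ : ∃ l, k = l + 1 := by
      have := Finset.card_pos.mpr ⟨x, hxT₃⟩
      exact ⟨k - 1, by have := hT₃.2.1; omega⟩
    have a1 := (hg.erase e).conn_erase_or_conn_contr h1 (by omega) hx'
    have a2 := (hg.contr he).conn_erase_or_conn_contr h2 (by omega) hx'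
    have a3 := ih (E.erase x).card (by omega) (hg.erase x) (by omega) he'
    have a4 := ih (E.erase x).card (by omega) (hg.contr hx) (by omega) he'
    rw [hB₀.erase_iff heB₀] at hT₁ hT₂
    rw [hB₁.contr_iff heB₁] at hT₃ hT₄
    have hcomm : PosTrop.contr (PosTrop.contr g e) x = PosTrop.contr (PosTrop.contr g x) e := by
      funext J
      simp only [PosTrop.contr, Finset.insert_comm]
    rw [Finset.erase_right_comm] at a1 a2
    rw [hcomm] at a2
    have d1 : Top (E.erase x) (k + 1 + 1) g T₂ := (hT₂.1.erase_iff hxT₂).2 ⟨hT₂.1, hxT₂⟩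
    have hxT₄' : x ∉ insert e T₄ := by simp [hxe, hxT₄]
    have d2 : Top (E.erase x) (k + 1 + 1) g (insert e T₄) :=
      (hT₄.1.erase_iff hxT₄').2 ⟨hT₄.1, hxT₄'⟩
    have c1 : Top (E.erase x) (k + 1) (PosTrop.contr g x) (T₁.erase x) := by
      rw [hT₁.1.contr_iff hxT₁, Finset.insert_erase hxT₁]
      exact ⟨hT₁.1, by simp⟩
    have hxT₃' : x ∈ insert e T₃ := by simp [hxT₃]
    have c2 : Top (E.erase x) (k + 1) (PosTrop.contr g x) ((insert e T₃).erase x) := by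
      rw [hT₃.1.contr_iff hxT₃', Finset.insert_erase hxT₃']
      exact ⟨hT₃.1, by simp⟩
    refine ⟨conn_of_conn_erase_or_conn_contr he' d1 hT₂.2 d2 (by simp) ?_,
      conn_of_conn_erase_or_conn_contr he' c1 (by simp [hT₁.2]) c2 (by simp [hxe.symm]) ?_⟩
    · rcases a1 with a1 | a1
      · exact Or.inl a1
      · rcases a2 with a2 | a2
        · exact Or.inr a2
        · exact (a4 a1 a2 rfl).elim
    · rcases a1 with a1 | a1
      · rcases a2 with a2 | a2
        · exact (a3 a1 a2 rfl).elim
        · exact Or.inr a2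
      · exact Or.inl a1
  refine hc.exists_not_conn hg hE (fun x hx => ?_) (fun x hx => ?_)
  · by_cases hxe : x = e
    · rwa [hxe]
    · exact (key x hx hxe).1
  · by_cases hxe : x = e
    · rwa [hxe]
    · exact (key x hx hxe).2

/-- The function `f` modified by the linear functional `μ`. -/
def twist (f : Finset α → ℝ) (μ : α → ℝ) : Finset α → ℝ := fun J => f J + ∑ x ∈ J, μ x

/-- The connected sets of maximizers of the functions `twist f μ`. -/
def facets (E : Finset α) (k : ℕ) (f : Finset α → ℝ) : Set (Set (Finset α)) :=
  {F | ∃ μ : α → ℝ, F = {I | Top E k (twist f μ) I} ∧ Conn E k (twist f μ)}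

/-- The members of `F` avoiding `e`. -/
def del (e : α) (F : Set (Finset α)) : Set (Finset α) := {I | I ∈ F ∧ e ∉ I}

/-- The members of `F` containing `e`, with `e` removed. -/
def con (e : α) (F : Set (Finset α)) : Set (Finset α) := {I | insert e I ∈ F ∧ e ∉ I}

variable {μ ν : α → ℝ} {F : Set (Finset α)}

lemma Generic.twist (hf : Generic E k f) (μ : α → ℝ) : Generic E k (twist f μ) := hf.add_sum μ

lemma exists_top (f : Finset α → ℝ) (h : k ≤ E.card) : ∃ B, Top E k f B := by
  obtain ⟨B, hB, hmax⟩ := Finset.exists_max_image _ f (Finset.powersetCard_nonempty.mpr h)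
  simp only [Finset.mem_powersetCard, and_imp] at hB hmax
  exact ⟨B, hB.1, hB.2, hmax⟩

lemma finite_facets : (facets E k f).Finite := by
  refine (E.powerset.finite_toSet.finite_subsets).subset ?_
  rintro F ⟨μ, rfl, -⟩ I hI
  simpa using hI.1

lemma conn_of_mem_facets {g : Finset α → ℝ} (h : {I | Top E k g I} ∈ facets E k f) :
    Conn E k g := by
  obtain ⟨μ, hμ, hc⟩ := h
  exact (conn_congr fun I => Set.ext_iff.mp hμ I).2 hc

lemma top_contr_twist : Top (E.erase e) k (contr (twist f μ) e) I ↔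
    Top (E.erase e) k (twist (contr f e) μ) I := by
  refine top_congr (μ e) fun J hJ _ => ?_
  rw [contr, twist, twist, contr, Finset.sum_insert (Finset.subset_erase.mp hJ).2]
  ring

lemma del_eq (hB : Top E k f B) (he : e ∉ B) :
    del e {I | Top E k f I} = {I | Top (E.erase e) k f I} := by
  ext I
  simp [del, hB.erase_iff he]

lemma con_eq (hB : Top E (k + 1) f B) (he : e ∈ B) :
    con e {I | Top E (k + 1) f I} = {I | Top (E.erase e) k (contr f e) I} := by
  ext I
  simp [con, hB.contr_iff he]

lemma eq_of_del_eq_of_con_eq {F' : Set (Finset α)} (h1 : del e F = del e F')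
    (h2 : con e F = con e F') : F = F' := by
  ext I
  by_cases he : e ∈ I
  · have := Set.ext_iff.mp h2 (I.erase e)
    simpa [con, Finset.insert_erase he] using this
  · have := Set.ext_iff.mp h1 I
    simpa [del, he] using this

/-- A connected set of maximizers determines the linear functional up to a constant. -/
lemma exists_eq_add_const (hf : Generic E k f) (hc : Conn E k (twist f μ))
    (h : {I | Top E k (twist f μ) I} = {I | Top E k (twist f ν) I}) :
    ∃ c, ∀ x ∈ E, ν x = μ x + c := by
  obtain ⟨B, hB⟩ := hc.1
  rcases E.eq_empty_or_nonempty with rfl | ⟨x₀, hx₀⟩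
  · exact ⟨0, by simp⟩
  refine ⟨ν x₀ - μ x₀, fun x hx => ?_⟩
  suffices hC : E.filter (fun x => ν x - μ x = ν x₀ - μ x₀) = E by
    rw [← hC, Finset.mem_filter] at hx
    linarith [hx.2]
  by_contra hC
  obtain ⟨i, hi, j, hj, hjB, hT, hij⟩ := hc.exists_exch (hf.twist μ) hB (Finset.filter_subset _ _)
    ⟨x₀, by simp [hx₀]⟩ hC
  have h1 := hB.eq_of_top hT
  have h2 := ((Set.ext_iff.mp h B).1 hB).eq_of_top ((Set.ext_iff.mp h _).1 hT)
  simp only [twist, sum_exch _ hi hjB] at h1 h2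
  have hd : ν i - μ i = ν j - μ j := by linarith
  simp [hB.1 hi, hj, hd] at hij

lemma top_twist_congr {c : ℝ} (h : ∀ x ∈ E, ν x = μ x + c) :
    Top E k (twist f ν) I ↔ Top E k (twist f μ) I := by
  refine top_congr (k * c) fun J hJ hk => ?_
  rw [twist, twist, Finset.sum_congr rfl fun x hx => h x (hJ hx), Finset.sum_add_distrib]
  simp [hk, add_assoc]

lemma eq_of_eq_add_const (he : e ∈ E) (hE : 2 ≤ E.card) {c : ℝ}
    (hμ : Conn E (k + 1) (twist f μ)) (hν : Conn E (k + 1) (twist f ν))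
    (h : ∀ x ∈ E.erase e, ν x = μ x + c) :
    {I | Top E (k + 1) (twist f ν) I} = {I | Top E (k + 1) (twist f μ) I} := by
  obtain ⟨⟨B₁, hB₁, heB₁⟩, B₀, hB₀, heB₀⟩ := hμ.exists_mem hE he
  obtain ⟨⟨T₁, hT₁, heT₁⟩, T₀, hT₀, heT₀⟩ := hν.exists_mem hE he
  apply eq_of_del_eq_of_con_eq (e := e)
  · rw [del_eq hT₀ heT₀, del_eq hB₀ heB₀]
    ext I
    exact top_twist_congr h
  · rw [con_eq hT₁ heT₁, con_eq hB₁ heB₁]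
    ext I
    exact top_contr_twist.trans ((top_twist_congr h).trans top_contr_twist.symm)

lemma twist_twist : (fun J => twist f μ J + ∑ x ∈ J, ν x) = twist f (fun x => μ x + ν x) := by
  funext J
  simp only [twist, Finset.sum_add_distrib, add_assoc]

/-- Extending a connected set of maximizers of the deletion or the contraction. -/
lemma exists_extension (he : e ∈ E) (μ : α → ℝ)
    (h0 : ∃ B, Top (E.erase e) (k + 1) (twist f μ) B)
    (h1 : ∃ B, Top (E.erase e) k (contr (twist f μ) e) B)
    (h : Conn (E.erase e) (k + 1) (twist f μ) ∨ Conn (E.erase e) k (contr (twist f μ) e)) :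
    ∃ F ∈ facets E (k + 1) f, del e F = {I | Top (E.erase e) (k + 1) (twist f μ) I} ∧
      con e F = {I | Top (E.erase e) k (twist (contr f e) μ) I} := by
  obtain ⟨t, ⟨B₀, hB₀, heB₀⟩, B₁, hB₁, heB₁⟩ := exists_equalize he h0 h1
  refine ⟨_, ⟨fun x => μ x + if x = e then t else 0, rfl, ?_⟩, ?_, ?_⟩
  · rw [← twist_twist]
    refine conn_of_conn_erase_or_conn_contr he hB₀ heB₀ hB₁ heB₁ ?_
    rwa [conn_congr fun _ => top_erase_add_sum e t, conn_congr fun _ => top_contr_add_sum e t]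
  · rw [← twist_twist, del_eq hB₀ heB₀]
    ext I
    exact top_erase_add_sum e t
  · rw [← twist_twist, con_eq hB₁ heB₁]
    ext I
    exact (top_contr_add_sum e t).trans top_contr_twist

lemma ncard_del (hf : Generic E (k + 1) f) (he : e ∈ E) (hE : 3 ≤ E.card) :
    {F ∈ facets E (k + 1) f | del e F ∈ facets (E.erase e) (k + 1) f}.ncard =
      (facets (E.erase e) (k + 1) f).ncard := by
  rw [← Set.InjOn.ncard_image (f := del e)]
  · congr 1
    ext G
    constructor
    · rintro ⟨F, hF, rfl⟩
      exact hF.2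
    · intro hG
      obtain ⟨μ, rfl, hc⟩ := id hG
      obtain ⟨B, hB⟩ := hc.1
      obtain ⟨F, hF, hdel, -⟩ := exists_extension he μ hc.1 (exists_top _ (by
        have := Finset.card_le_card hB.1
        have := hB.2.1
        omega)) (Or.inl hc)
      exact ⟨F, ⟨hF, hdel ▸ hG⟩, hdel⟩
  · rintro _ ⟨⟨μ, rfl, hμ⟩, h1⟩ _ ⟨⟨ν, rfl, hν⟩, h2⟩ heq
    obtain ⟨⟨B₁, hB₁, heB₁⟩, B₀, hB₀, heB₀⟩ := hμ.exists_mem (by omega) he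
    obtain ⟨⟨T₁, hT₁, heT₁⟩, T₀, hT₀, heT₀⟩ := hν.exists_mem (by omega) he
    rw [del_eq hB₀ heB₀] at h1 heq
    rw [del_eq hT₀ heT₀] at heq
    obtain ⟨c, hc⟩ := exists_eq_add_const (hf.erase e) (conn_of_mem_facets h1) heq
    exact (eq_of_eq_add_const he (by omega) hμ hν hc).symm

lemma ncard_con (hf : Generic E (k + 1) f) (he : e ∈ E) (hE : 3 ≤ E.card) :
    {F ∈ facets E (k + 1) f | con e F ∈ facets (E.erase e) k (contr f e)}.ncard =
      (facets (E.erase e) k (contr f e)).ncard := by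
  have hcard := Finset.card_erase_of_mem he
  rw [← Set.InjOn.ncard_image (f := con e)]
  · congr 1
    ext G
    constructor
    · rintro ⟨F, hF, rfl⟩
      exact hF.2
    · intro hG
      obtain ⟨μ, rfl, hc⟩ := id hG
      rw [← conn_congr fun _ => top_contr_twist] at hc
      obtain ⟨x, hx⟩ : (E.erase e).Nonempty := Finset.card_pos.mp (by omega)
      obtain ⟨-, B, hB, hxB⟩ := hc.exists_mem (by omega) hx
      obtain ⟨F, hF, -, hcon⟩ := exists_extension he μ (exists_top _ (by
        have := Finset.card_lt_card (Finset.ssubset_iff_subset_ne.mpr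
          ⟨hB.1, by rintro rfl; exact hxB hx⟩)
        have := hB.2.1
        omega)) hc.1 (Or.inr hc)
      exact ⟨F, ⟨hF, hcon ▸ hG⟩, hcon⟩
  · rintro _ ⟨⟨μ, rfl, hμ⟩, h1⟩ _ ⟨⟨ν, rfl, hν⟩, h2⟩ heq
    obtain ⟨⟨B₁, hB₁, heB₁⟩, B₀, hB₀, heB₀⟩ := hμ.exists_mem (by omega) he
    obtain ⟨⟨T₁, hT₁, heT₁⟩, T₀, hT₀, heT₀⟩ := hν.exists_mem (by omega) he
    rw [con_eq hB₁ heB₁] at h1 heq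
    rw [con_eq hT₁ heT₁] at heq
    simp only [top_contr_twist] at h1 heq
    obtain ⟨c, hc⟩ := exists_eq_add_const (hf.contr he) (conn_of_mem_facets h1) heq
    exact (eq_of_eq_add_const he (by omega) hμ hν hc).symm

/-- Deletion-contraction recursion for the number of facets. -/
lemma ncard_facets_eq_add (hf : Generic E (k + 1) f) (he : e ∈ E) (hE : 3 ≤ E.card) :
    (facets E (k + 1) f).ncard =
      (facets (E.erase e) (k + 1) f).ncard + (facets (E.erase e) k (contr f e)).ncard := by
  rw [← ncard_del hf he hE, ← ncard_con hf he hE, ← Set.ncard_union_eq _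
    (finite_facets.subset (Set.sep_subset _ _)) (finite_facets.subset (Set.sep_subset _ _))]
  · congr 1
    ext F
    simp only [Set.mem_union, Set.mem_ofPred_eq, ← and_or_left]
    refine ⟨fun hF => ⟨hF, ?_⟩, fun h => h.1⟩
    obtain ⟨μ, rfl, hc⟩ := hF
    obtain ⟨⟨B₁, hB₁, heB₁⟩, B₀, hB₀, heB₀⟩ := hc.exists_mem (by omega) he
    rw [del_eq hB₀ heB₀, con_eq hB₁ heB₁]
    refine ((hf.twist μ).conn_erase_or_conn_contr hc (by omega) he).imp
      (fun h => ⟨μ, rfl, h⟩) (fun h => ⟨μ, ?_, ?_⟩)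
    · simp only [top_contr_twist]
    · rwa [conn_congr fun _ => top_contr_twist] at h
  · rw [Set.disjoint_left]
    rintro _ ⟨⟨μ, rfl, hc⟩, h1⟩ ⟨-, h2⟩
    obtain ⟨⟨B₁, hB₁, heB₁⟩, B₀, hB₀, heB₀⟩ := hc.exists_mem (by omega) he
    rw [del_eq hB₀ heB₀] at h1
    rw [con_eq hB₁ heB₁] at h2
    exact (hf.twist μ).not_conn_erase_and_conn_contr hE he (conn_of_mem_facets h1)
      (conn_of_mem_facets h2)

lemma facets_zero (hE : 2 ≤ E.card) : facets E 0 f = ∅ := by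
  rw [Set.eq_empty_iff_forall_notMem]
  rintro _ ⟨μ, rfl, hc⟩
  obtain ⟨e, he⟩ : E.Nonempty := Finset.card_pos.mp (by omega)
  obtain ⟨⟨B, hB, heB⟩, -⟩ := hc.exists_mem hE he
  rw [Finset.card_eq_zero.mp hB.2.1] at heB
  simp at heB

lemma facets_one (hE : 2 ≤ E.card) : facets E 1 f = {{I | I ⊆ E ∧ I.card = 1}} := by
  ext F
  rw [Set.mem_singleton_iff]
  constructor
  · rintro ⟨μ, rfl, hc⟩
    ext I
    refine ⟨fun h => ⟨h.1, h.2.1⟩, fun ⟨h1, h2⟩ => ?_⟩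
    obtain ⟨x, rfl⟩ := Finset.card_eq_one.mp h2
    obtain ⟨⟨B, hB, hxB⟩, -⟩ := hc.exists_mem hE (h1 (Finset.mem_singleton_self x))
    obtain ⟨y, rfl⟩ := Finset.card_eq_one.mp hB.2.1
    rw [Finset.mem_singleton.mp hxB]
    exact hB
  · rintro rfl
    have htop : ∀ I, Top E 1 (twist f fun x => -f {x}) I ↔ I ⊆ E ∧ I.card = 1 := by
      have hval : ∀ I : Finset α, I.card = 1 → twist f (fun x => -f {x}) I = 0 := by
        intro I hI
        obtain ⟨x, rfl⟩ := Finset.card_eq_one.mp hI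
        simp [twist]
      refine fun I => ⟨fun h => ⟨h.1, h.2.1⟩, fun ⟨h1, h2⟩ => ⟨h1, h2, fun J _ hJ => ?_⟩⟩
      rw [hval I h2, hval J hJ]
    refine ⟨fun x => -f {x}, by simp only [htop], ?_, fun C hC ⟨x, hx⟩ hCE => ?_⟩
    · obtain ⟨e, he⟩ : E.Nonempty := Finset.card_pos.mp (by omega)
      exact ⟨{e}, (htop _).2 (by simpa using he)⟩
    · obtain ⟨y, hy, hyC⟩ := Finset.exists_of_ssubset (Finset.ssubset_iff_subset_ne.mpr ⟨hC, hCE⟩)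
      refine ⟨{x}, {y}, (htop _).2 (by simpa using hC hx), (htop _).2 (by simpa using hy), ?_⟩
      simp [hx, hyC]

/-- The number of facets of a finest positroidal subdivision. -/
lemma ncard_facets {m : ℕ} (hf : Generic E (k + 1) f) (hE : E.card = m + 2) :
    (facets E (k + 1) f).ncard = m.choose k := by
  induction m generalizing E k f with
  | zero =>
    rcases k with _ | k
    · rw [facets_one hE.ge]
      simp
    · rw [Nat.choose_zero_succ, Set.ncard_eq_zero finite_facets, Set.eq_empty_iff_forall_notMem]
      rintro _ ⟨μ, rfl, hc⟩
      have := hc.eq_one_of_card_two hE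
      omega
  | succ m ih =>
    obtain ⟨e, he⟩ : E.Nonempty := Finset.card_pos.mp (by omega)
    have hcard : (E.erase e).card = m + 2 := by
      rw [Finset.card_erase_of_mem he]
      omega
    rw [ncard_facets_eq_add hf he (by omega), ih (hf.erase e) hcard]
    rcases k with _ | k
    · rw [facets_zero (by omega)]
      simp
    · rw [ih (hf.contr he) hcard, Nat.choose_succ_succ, add_comm]

end Exchange

section Polytope

variable {n k : ℕ} {P : Finset (Fin n) → ℝ} {f : Finset (Fin n) → ℝ}

/-- The indicator vector of a subset of `[n]`. -/
def indic (I : Finset (Fin n)) : Fin n → ℝ := fun i => if i ∈ I then 1 else 0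

/-- The functional summing the coordinates in `C`. -/
def coordSum (C : Finset (Fin n)) : Module.Dual ℝ (Fin n → ℝ) :=
  ∑ i ∈ C, LinearMap.proj i

lemma coordSum_apply (C : Finset (Fin n)) (x : Fin n → ℝ) : coordSum C x = ∑ i ∈ C, x i := by
  simp [coordSum]

lemma coordSum_indic (C I : Finset (Fin n)) : coordSum C (indic I) = (I ∩ C).card := by
  rw [coordSum_apply, Finset.inter_comm, ← sum_indicator]
  rfl

lemma finrank_ker_coordSum (hn : 0 < n) :
    Module.finrank ℝ (LinearMap.ker (coordSum (Finset.univ : Finset (Fin n)))) = n - 1 := by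
  have h : coordSum (Finset.univ : Finset (Fin n)) ≠ 0 := by
    intro h
    have := LinearMap.congr_fun h (indic {⟨0, hn⟩})
    rw [coordSum_indic] at this
    simp at this
  have := Module.Dual.finrank_ker_add_one_of_ne_zero h
  rw [Module.finrank_fin_fun] at this
  omega

lemma direction_familyPolytope (ℬ : Set (Finset (Fin n))) :
    (affineSpan ℝ (familyPolytope n ℬ)).direction = vectorSpan ℝ (indic '' ℬ) := by
  rw [familyPolytope, affineSpan_convexHull, direction_affineSpan]
  congr 1
  ext x
  simp [indic, funext_iff, eq_comm]

lemma vectorSpan_le_ker {ℬ : Set (Finset (Fin n))} {C : Finset (Fin n)}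
    (h : ∀ I ∈ ℬ, ∀ J ∈ ℬ, (I ∩ C).card = (J ∩ C).card) :
    vectorSpan ℝ (indic '' ℬ) ≤ LinearMap.ker (coordSum C) := by
  rw [vectorSpan, Submodule.span_le]
  rintro _ ⟨_, ⟨I, hI, rfl⟩, _, ⟨J, hJ, rfl⟩, rfl⟩
  simp [coordSum_indic, h I hI J hJ]

lemma indic_exch {B : Finset (Fin n)} {i j : Fin n} (hi : i ∈ B) (hj : j ∉ B) :
    indic (exch B i j) - indic B = indic {j} - indic {i} := by
  funext x
  simp only [indic, Pi.sub_apply, mem_exch, Finset.mem_singleton]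
  by_cases hxj : x = j
  · subst hxj
    have : x ≠ i := by rintro rfl; exact hj hi
    simp [hj, this]
  · by_cases hxi : x = i
    · subst hxi
      simp [hxj, hi]
    · simp [hxj, hxi]

/-- The maximizers span a facet if and only if they are connected. -/
lemma finrank_direction_eq_iff (hf : Generic Finset.univ k f) (hn : 0 < n) (hk : k ≤ n) :
    Module.finrank ℝ
      (affineSpan ℝ (familyPolytope n {I | Top Finset.univ k f I})).direction = n - 1 ↔
      Conn Finset.univ k f := by
  rw [direction_familyPolytope, ← finrank_ker_coordSum hn]
  obtain ⟨B, hB⟩ := exists_top (E := Finset.univ) f (by simpa using hk)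
  have hle : vectorSpan ℝ (indic '' {I | Top Finset.univ k f I}) ≤
      LinearMap.ker (coordSum Finset.univ) :=
    vectorSpan_le_ker fun I hI J hJ => by simp [hI.2.1, hJ.2.1]
  constructor
  · intro h
    by_contra hc
    obtain ⟨C, -, hC0, hC, hconst⟩ := exists_cut hB hc (Finset.mem_univ ⟨0, hn⟩)
    have hker := Submodule.eq_of_le_of_finrank_eq hle h
    obtain ⟨y, -, hy⟩ := Finset.exists_of_ssubset
      (Finset.ssubset_iff_subset_ne.mpr ⟨Finset.subset_univ C, hC⟩)
    have hmem : indic {⟨0, hn⟩} - indic {y} ∈ LinearMap.ker (coordSum Finset.univ) := by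
      simp [coordSum_indic]
    rw [← hker] at hmem
    have := vectorSpan_le_ker (C := C) (fun I hI J hJ => hconst I J hI hJ) hmem
    simp [coordSum_indic, hC0, hy] at this
  · intro hc
    suffices h : LinearMap.ker (coordSum Finset.univ) ≤
        vectorSpan ℝ (indic '' {I | Top Finset.univ k f I}) by rw [le_antisymm hle h]
    intro x hx
    have hall : ∀ i, indic {i} - indic {⟨0, hn⟩} ∈
        vectorSpan ℝ (indic '' {I | Top Finset.univ k f I}) := by
      classical
      by_contra! hno
      obtain ⟨y, hy⟩ := hno
      obtain ⟨i, hi, j, hj, hjB, hT, hij⟩ := hc.exists_exch hf hB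
        (C := Finset.univ.filter fun i => indic {i} - indic {⟨0, hn⟩} ∈
          vectorSpan ℝ (indic '' {I | Top Finset.univ k f I})) (Finset.subset_univ _)
        ⟨⟨0, hn⟩, by simp⟩ (fun h => hy (by simpa using h.ge (Finset.mem_univ y)))
      have hmem : indic {j} - indic {i} ∈
          vectorSpan ℝ (indic '' {I | Top Finset.univ k f I}) := by
        rw [← indic_exch hi hjB]
        exact vsub_mem_vectorSpan ℝ ⟨_, hT, rfl⟩ ⟨_, hB, rfl⟩
      simp only [Finset.mem_filter, Finset.mem_univ, true_and] at hij
      by_cases h : indic {i} - indic {⟨0, hn⟩} ∈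
          vectorSpan ℝ (indic '' {I | Top Finset.univ k f I})
      · exact hij.1 h (by simpa using add_mem hmem h)
      · exact h (hij.2 fun hj' => h (by simpa using sub_mem hj' hmem))
    have hx' : x = ∑ i, x i • (indic {i} - indic {⟨0, hn⟩}) := by
      rw [LinearMap.mem_ker, coordSum_apply] at hx
      simp only [smul_sub, Finset.sum_sub_distrib, ← Finset.sum_smul, hx, zero_smul, sub_zero]
      funext y
      simp [indic]
    rw [hx']
    exact sum_mem fun i _ => Submodule.smul_mem _ _ (hall i)

lemma faceOf_eq (lam : Fin n → ℝ) :
    FaceOf n k P lam = {I | Top Finset.univ k (twist (fun I => -P I) lam) I} := by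
  ext I
  simp [FaceOf, Top, twist, sub_eq_neg_add]

lemma generic_neg (hP : IsPosTropPlucker n k P)
    (hoct : ∀ S : Finset (Fin n), S.card + 2 = k →
      ∀ a b c d : Fin n, a < b → b < c → c < d →
        a ∉ S → b ∉ S → c ∉ S → d ∉ S →
        P (S ∪ {a, b}) + P (S ∪ {c, d}) ≠ P (S ∪ {a, d}) + P (S ∪ {b, c})) :
    Generic Finset.univ k (fun I => -P I) := by
  intro S _ hS a _ b _ c _ d _ hab hbc hcd haS hbS hcS hdS
  have h1 := hP S hS a b c d hab hbc hcd haS hbS hcS hdS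
  have h2 := hoct S hS a b c d hab hbc hcd haS hbS hcS hdS
  have hs : ∀ x y : Fin n, S ∪ {x, y} = insert x (insert y S) := by
    intro x y
    ext z
    simp only [Finset.mem_union, Finset.mem_insert, Finset.mem_singleton]
    tauto
  simp only [hs] at h1 h2
  refine ⟨?_, fun h => h2 (by linarith)⟩
  rcases h1 with ⟨h3, h4⟩ | ⟨h3, h4⟩
  · rw [max_eq_left (by linarith)]
    linarith
  · rw [max_eq_right (by linarith)]
    linarith

end Polytope

end PosTrop

/-- A finest regular positroidal subdivision of the hypersimplex `Δ_{k,n}` has exactly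
`C(n-2, k-1)` facets, achieving equality in the `f`-vector theorem. -/
theorem stmt_10 (k n : ℕ) (hk : 0 < k) (hkn : k < n) (P : Finset (Fin n) → ℝ)
    (hP : IsPosTropPlucker n k P)
    (hoct : ∀ S : Finset (Fin n), S.card + 2 = k →
      ∀ a b c d : Fin n, a < b → b < c → c < d →
        a ∉ S → b ∉ S → c ∉ S → d ∉ S →
        P (S ∪ {a, b}) + P (S ∪ {c, d}) ≠ P (S ∪ {a, d}) + P (S ∪ {b, c})) :
    Set.ncard {ℬ : Set (Finset (Fin n)) |
        (∃ lam : Fin n → ℝ, ℬ = FaceOf n k P lam) ∧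
        Module.finrank ℝ (affineSpan ℝ (familyPolytope n ℬ)).direction = n - 1} =
      Nat.choose (n - 2) (k - 1) := by
  have hgen := PosTrop.generic_neg hP hoct
  have hset : {ℬ : Set (Finset (Fin n)) | (∃ lam : Fin n → ℝ, ℬ = FaceOf n k P lam) ∧
      Module.finrank ℝ (affineSpan ℝ (familyPolytope n ℬ)).direction = n - 1} =
      PosTrop.facets Finset.univ k (fun I => -P I) := by
    ext ℬ
    constructor
    · rintro ⟨⟨lam, rfl⟩, h⟩
      rw [PosTrop.faceOf_eq] at h ⊢
      exact ⟨lam, rfl, (PosTrop.finrank_direction_eq_iff (hgen.twist lam) (by omega) hkn.le).1 h⟩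
    · rintro ⟨lam, rfl, h⟩
      exact ⟨⟨lam, (PosTrop.faceOf_eq lam).symm⟩,
        (PosTrop.finrank_direction_eq_iff (hgen.twist lam) (by omega) hkn.le).2 h⟩
  rw [hset]
  obtain ⟨k, rfl⟩ : ∃ l, k = l + 1 := ⟨k - 1, by omega⟩
  rw [Nat.add_sub_cancel]
  refine PosTrop.ncard_facets hgen ?_
  rw [Finset.card_univ, Fintype.card_fin]
  omega
end

section
/- Let A be a k×n matrix over the field 𝕂 = HahnSeries ℝ ℝ such that every maximal minor p_I(A) is nonzero, and set P(I) := ord(p_I(A)) for each k-element subset I of [n]. Then for every λ ∈ ℝⁿ, there exists a real k×n matrix B such that { I : p_I(B) ≠ 0 } = Face_P(λ), the set of k-subsets I maximizing Σ_{i∈I} λ_i − P(I). (Every face of the matroidal subdivision D_P induced by a realizable tropical Plücker vector corresponds to a realizable matroid.) -/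
/-- The order (valuation) of a Hahn series with real exponents. -/
noncomputable def ord (f : HahnSeries ℝ ℝ) : ℝ := f.order

/-- The maximal minor `p_I(A)` of a `k × n` matrix `A` on the columns indexed by the
`k`-element subset `I`, taken in increasing order (junk value `0` if `I.card ≠ k`). -/
noncomputable def pMinor {R : Type*} [CommRing R] {k n : ℕ}
    (A : Matrix (Fin k) (Fin n) R) (I : Finset (Fin n)) : R :=
  if hI : I.card = k then
    Matrix.det (Matrix.of fun r c => A r ((I.orderIsoOfFin hI c : Fin n)))
  else 0

namespace HahnSeries

variable {Γ R : Type*} [AddCommMonoid Γ] [LinearOrder Γ] [IsOrderedCancelAddMonoid Γ]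

/-- The constant coefficient is multiplicative on Hahn series of nonnegative order. -/
theorem coeff_zero_mul_of_orderTop_nonneg [NonUnitalNonAssocSemiring R] {x y : HahnSeries Γ R}
    (hx : 0 ≤ x.orderTop) (hy : 0 ≤ y.orderTop) :
    (x * y).coeff 0 = x.coeff 0 * y.coeff 0 := by
  have nonneg {z : HahnSeries Γ R} (hz : 0 ≤ z.orderTop) {i : Γ} (hi : z.coeff i ≠ 0) : 0 ≤ i := by
    exact_mod_cast hz.trans (orderTop_le_of_coeff_ne_zero hi)
  rw [coeff_mul]
  refine Finset.sum_eq_single (0, 0) ?_ ?_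
  · rintro ⟨i, j⟩ hij hne
    rw [Finset.mem_antidiagonal] at hij
    obtain ⟨hi, hj, h⟩ := hij
    refine absurd ?_ hne
    obtain ⟨h1, h2⟩ := (add_eq_zero_iff_of_nonneg (nonneg hx hi) (nonneg hy hj)).1 h
    simp_all
  · intro h
    by_contra hne
    refine h ?_
    rw [Finset.mem_antidiagonal]
    exact ⟨left_ne_zero_of_mul hne, right_ne_zero_of_mul hne, add_zero 0⟩

variable (Γ R) in
/-- The subring of Hahn series of nonnegative order. -/
def integers [Ring R] [Nontrivial R] : Subring (HahnSeries Γ R) where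
  carrier := {x | 0 ≤ x.orderTop}
  mul_mem' hx hy := Set.mem_ofPred.2 <|
    (add_nonneg (Set.mem_ofPred.1 hx) (Set.mem_ofPred.1 hy)).trans orderTop_add_le_mul
  one_mem' := by simp
  add_mem' hx hy := Set.mem_ofPred.2 <|
    (le_min (Set.mem_ofPred.1 hx) (Set.mem_ofPred.1 hy)).trans min_orderTop_le_orderTop_add
  zero_mem' := by simp
  neg_mem' {x} hx := by simpa using hx

theorem mem_integers [Ring R] [Nontrivial R] {x : HahnSeries Γ R} :
    x ∈ integers Γ R ↔ 0 ≤ x.orderTop :=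
  Set.mem_ofPred

variable (Γ R) in
/-- The residue map, sending a Hahn series of nonnegative order to its constant coefficient. -/
def residue [Ring R] [Nontrivial R] : integers Γ R →+* R where
  toFun x := x.1.coeff 0
  map_one' := by simp
  map_zero' := by simp
  map_add' x y := by simp
  map_mul' x y := coeff_zero_mul_of_orderTop_nonneg (mem_integers.1 x.2) (mem_integers.1 y.2)

theorem residue_ne_zero_iff [Ring R] [Nontrivial R] (x : integers Γ R) :
    residue Γ R x ≠ 0 ↔ x.1.orderTop = 0 :=
  ⟨fun h => (orderTop_le_of_coeff_ne_zero h).antisymm (mem_integers.1 x.2), fun h => coeff_orderTop_ne h⟩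

end HahnSeries

section Minors

variable {R S : Type*} [CommRing R] [CommRing S] {k n : ℕ}

theorem pMinor_eq_det_submatrix (A : Matrix (Fin k) (Fin n) R) {I : Finset (Fin n)}
    (hI : I.card = k) : pMinor A I = (A.submatrix id (I.orderEmbOfFin hI)).det := by
  rw [pMinor, dif_pos hI]
  rfl

theorem pMinor_map (f : R →+* S) (A : Matrix (Fin k) (Fin n) R) (I : Finset (Fin n)) :
    pMinor (A.map f) I = f (pMinor A I) := by
  by_cases hI : I.card = k
  · rw [pMinor_eq_det_submatrix _ hI, pMinor_eq_det_submatrix _ hI, RingHom.map_det]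
    rfl
  · simp [pMinor, hI]

theorem pMinor_mul (N : Matrix (Fin k) (Fin k) R) (A : Matrix (Fin k) (Fin n) R)
    (I : Finset (Fin n)) : pMinor (N * A) I = N.det * pMinor A I := by
  by_cases hI : I.card = k
  · rw [pMinor_eq_det_submatrix _ hI, pMinor_eq_det_submatrix _ hI, ← Matrix.det_mul]
    rfl
  · simp [pMinor, hI]

/-- Rescaling the columns of a matrix rescales its maximal minors. -/
theorem pMinor_scale_columns (v : Fin n → R) (A : Matrix (Fin k) (Fin n) R)
    (I : Finset (Fin n)) :
    pMinor (Matrix.of fun i j => v j * A i j) I = (∏ i ∈ I, v i) * pMinor A I := by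
  by_cases hI : I.card = k
  · rw [pMinor_eq_det_submatrix _ hI, pMinor_eq_det_submatrix _ hI]
    have hprod : ∏ i ∈ I, v i = ∏ c, v (I.orderEmbOfFin hI c) := by
      conv_lhs => rw [← Finset.image_orderEmbOfFin_univ I hI]
      exact Finset.prod_image (I.orderEmbOfFin hI).injective.injOn
    rw [hprod, ← Matrix.det_mul_row]
    rfl
  · simp [pMinor, hI]

/-- The determinant of `k` arbitrarily chosen columns vanishes or is a maximal minor up to sign. -/
theorem det_submatrix_eq_zero_or_pMinor (A : Matrix (Fin k) (Fin n) R) (f : Fin k → Fin n) :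
    (A.submatrix id f).det = 0 ∨ ∃ I : Finset (Fin n), I.card = k ∧
      ((A.submatrix id f).det = pMinor A I ∨ (A.submatrix id f).det = -pMinor A I) := by
  by_cases hf : Function.Injective f
  · right
    have hI : (Finset.univ.image f).card = k := by
      simp [Finset.card_image_of_injective _ hf]
    refine ⟨Finset.univ.image f, hI, ?_⟩
    let e := (Finset.univ.image f).orderIsoOfFin hI
    let g : Fin k → Fin k := fun c => e.symm ⟨f c, by simp⟩
    have hg : Function.Injective g := fun a b h => hf (by simpa [g] using h)
    let σ : Equiv.Perm (Fin k) := Equiv.ofBijective g (Finite.injective_iff_bijective.1 hg)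
    have hσ : f = (Finset.univ.image f).orderEmbOfFin hI ∘ σ := by
      funext c
      change f c = (e (e.symm ⟨f c, _⟩) : Fin n)
      rw [OrderIso.apply_symm_apply]
    have hdet : (A.submatrix id f).det = Equiv.Perm.sign σ * pMinor A (Finset.univ.image f) := by
      rw [pMinor_eq_det_submatrix _ hI, ← Matrix.det_permute', Matrix.submatrix_submatrix, ← hσ]
      rfl
    rcases Int.units_eq_one_or (Equiv.Perm.sign σ) with h | h <;> simp [hdet, h]
  · left
    simp only [Function.Injective, not_forall] at hf
    obtain ⟨a, b, hab, hne⟩ := hf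
    exact Matrix.det_zero_of_column_eq hne fun i => by simp [hab]

end Minors

open HahnSeries in
/-- If `I₀` minimizes the order of the maximal minors of `M`, then reducing
`M` modulo the column basis `I₀` gives a matrix over the residue field whose nonzero minors
are those of minimal order. -/
theorem exists_matrix_pMinor_ne_zero_iff {Γ F : Type*} [AddCommGroup Γ] [LinearOrder Γ]
    [IsOrderedAddMonoid Γ] [Field F] {k n : ℕ}
    (M : Matrix (Fin k) (Fin n) (HahnSeries Γ F)) {I₀ : Finset (Fin n)} (hI₀ : I₀.card = k)
    (h₀ : pMinor M I₀ ≠ 0)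
    (hmin : ∀ I : Finset (Fin n), I.card = k →
      (pMinor M I₀).orderTop ≤ (pMinor M I).orderTop) :
    ∃ B : Matrix (Fin k) (Fin n) F, ∀ I : Finset (Fin n),
      pMinor B I ≠ 0 ↔ (pMinor M I).orderTop = (pMinor M I₀).orderTop := by
  have hfin : (pMinor M I₀).orderTop ≠ ⊤ := orderTop_ne_top.2 h₀
  have hdiv (y : HahnSeries Γ F) :
      (pMinor M I₀).orderTop + ((pMinor M I₀)⁻¹ * y).orderTop = y.orderTop := by
    rw [← orderTop_mul, mul_inv_cancel_left₀ h₀]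
  have hnonneg (y : HahnSeries Γ F) (hy : (pMinor M I₀).orderTop ≤ y.orderTop) :
      0 ≤ ((pMinor M I₀)⁻¹ * y).orderTop := by
    rw [← WithTop.add_le_add_iff_left hfin, hdiv, add_zero]
    exact hy
  have hdet := pMinor_eq_det_submatrix M hI₀
  set N := M.submatrix id (I₀.orderEmbOfFin hI₀) with hN
  have hunit : IsUnit N.det := (hdet ▸ h₀).isUnit
  have hentry (r : Fin k) (j : Fin n) : 0 ≤ ((N⁻¹ * M) r j).orderTop := by
    have hcramer : (N⁻¹ * M) r j = (pMinor M I₀)⁻¹ *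
        (M.submatrix id (Function.update (I₀.orderEmbOfFin hI₀) r j)).det := by
      have hupd : M.submatrix id (Function.update (I₀.orderEmbOfFin hI₀) r j) =
          N.updateCol r (fun i => M i j) := by
        ext a b
        by_cases hb : b = r
        · subst hb; simp
        · simp [hb, hN]
      rw [hupd, ← Matrix.cramer_apply, ← N.det_smul_inv_mulVec_eq_cramer _ hunit, hdet]
      rw [Pi.smul_apply, smul_eq_mul, inv_mul_cancel_left₀ hunit.ne_zero]
      rfl
    rw [hcramer]
    apply hnonneg
    rcases det_submatrix_eq_zero_or_pMinor M (Function.update (I₀.orderEmbOfFin hI₀) r j) with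
      h | ⟨I, hI, h | h⟩
    · simp [h]
    · exact h ▸ hmin I hI
    · rw [h, orderTop_neg]
      exact hmin I hI
  let C : Matrix (Fin k) (Fin n) (integers Γ F) := Matrix.of fun r j => ⟨(N⁻¹ * M) r j, mem_integers.2 (hentry r j)⟩
  refine ⟨C.map (residue Γ F), fun I => ?_⟩
  have hC : ((pMinor C I :) : HahnSeries Γ F) = (pMinor M I₀)⁻¹ * pMinor M I := by
    rw [← Subring.subtype_apply, ← pMinor_map, hdet, ← Ring.inverse_eq_inv',
      ← Matrix.det_nonsing_inv, ← pMinor_mul]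
    rfl
  rw [pMinor_map, residue_ne_zero_iff, hC, ← hdiv (pMinor M I),
    ← WithTop.add_right_inj hfin, zero_add, add_comm]

/-- Every face of the matroidal subdivision of the hypersimplex induced by a realizable
tropical Plücker vector corresponds to a realizable matroid: if `P(I) = ord (p_I(A))`
for a matrix `A` over the Hahn series field with all maximal minors nonzero, then for
each `λ` there is a real matrix `B` whose nonvanishing maximal minors are indexed
exactly by `Face_P(λ)`. -/
theorem stmt_11 (k n : ℕ) (hk : 0 < k) (hkn : k < n)
    (A : Matrix (Fin k) (Fin n) (HahnSeries ℝ ℝ))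
    (hA : ∀ I : Finset (Fin n), I.card = k → pMinor A I ≠ 0)
    (P : Finset (Fin n) → ℝ)
    (hP : ∀ I : Finset (Fin n), I.card = k → P I = ord (pMinor A I)) :
    ∀ lam : Fin n → ℝ, ∃ B : Matrix (Fin k) (Fin n) ℝ,
      ∀ I : Finset (Fin n), (I.card = k ∧ pMinor B I ≠ 0) ↔ I ∈ FaceOf n k P lam := by
  intro lam
  let M : Matrix (Fin k) (Fin n) (HahnSeries ℝ ℝ) :=
    Matrix.of fun i j => HahnSeries.single (-lam j) 1 * A i j
  have hprod (I : Finset (Fin n)) :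
      ∏ i ∈ I, HahnSeries.single (-lam i) (1 : ℝ) = HahnSeries.single (-∑ i ∈ I, lam i) 1 := by
    induction I using Finset.induction_on with
    | empty => simp
    | insert a s ha ih =>
      simp [Finset.prod_insert ha, Finset.sum_insert ha, ih, add_comm]
  have hM (I : Finset (Fin n)) (hI : I.card = k) :
      (pMinor M I).orderTop = ((P I - ∑ i ∈ I, lam i : ℝ) : WithTop ℝ) := by
    rw [pMinor_scale_columns, hprod, HahnSeries.orderTop_mul,
      HahnSeries.orderTop_single one_ne_zero, ← HahnSeries.order_eq_orderTop_of_ne_zero (hA I hI),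
      hP I hI, ← WithTop.coe_add, ord, neg_add_eq_sub]
  obtain ⟨I₀, hI₀, hmin⟩ := (Finset.powersetCard k (Finset.univ : Finset (Fin n))).exists_min_image
    (fun I => P I - ∑ i ∈ I, lam i) (Finset.powersetCard_nonempty.2 (by simpa using hkn.le))
  simp only [Finset.mem_powersetCard_univ] at hI₀ hmin
  obtain ⟨B, hB⟩ := exists_matrix_pMinor_ne_zero_iff M hI₀
    (by rw [← HahnSeries.orderTop_ne_top, hM I₀ hI₀]; exact WithTop.coe_ne_top)
    (fun I hI => by rw [hM I hI, hM I₀ hI₀]; exact_mod_cast hmin I hI)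
  refine ⟨B, fun I => and_congr_right fun hI => ?_⟩
  rw [hB, hM I hI, hM I₀ hI₀, WithTop.coe_inj]
  constructor
  · intro h J hJ
    linarith [hmin J hJ]
  · intro h
    linarith [h I₀ hI₀, hmin I hI]
end

section
/- Let 0 < k < n, let I be a k-element subset of [n] with complement J, and let X ⊆ I × J. The following are equivalent: (1) the set of points { e_I − e_i + e_j : (i,j) ∈ X } ⊂ ℝⁿ is the vertex set of an (n−2)-dimensional simplex, i.e., |X| = n−1 and these points are affinely independent; (2) the bipartite graph G(X) on vertex set [n] = I ⊔ J with an edge between i ∈ I and j ∈ J exactly when (i,j) ∈ X is a tree on all n vertices (connected and acyclic). -/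
/-- The point `e_I - e_i + e_j` of `ℝⁿ`, for `p = (i, j)`. -/
noncomputable def vtx {n : ℕ} (I : Finset (Fin n)) (p : Fin n × Fin n) : Fin n → ℝ :=
  fun x => (if x ∈ I then (1 : ℝ) else 0) - (if x = p.1 then 1 else 0)
    + (if x = p.2 then 1 else 0)

theorem affineIndependent_add_const_iff {ι k V : Type*} [Ring k] [AddCommGroup V] [Module k V]
    (c : V) (v : ι → V) (f : V →ₗ[k] k) (hf : ∀ i, f (v i) = 1) :
    AffineIndependent k (fun i => c + v i) ↔ LinearIndependent k v := by
  have key (s : Finset ι) (w : ι → k) :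
      ∑ i ∈ s, w i • (c + v i) = (∑ i ∈ s, w i) • c + ∑ i ∈ s, w i • v i := by
    simp only [smul_add, Finset.sum_add_distrib, Finset.sum_smul]
  rw [affineIndependent_iff, linearIndependent_iff']
  constructor
  · intro h s w hw
    have hs : ∑ i ∈ s, w i = 0 := by simpa [hf] using congrArg f hw
    exact h s w hs (by rw [key, hs, hw, zero_smul, add_zero])
  · intro h s w hs hw
    rw [key, hs, zero_smul, zero_add] at hw
    exact h s w hw

/-- The rows of a matrix are linearly independent iff its rank is the number of rows. -/
theorem Matrix.linearIndependent_row_iff_rank_eq {m n K : Type*} [Fintype m] [Fintype n] [Field K]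
    (A : Matrix m n K) : LinearIndependent K A.row ↔ A.rank = Fintype.card m := by
  rw [linearIndependent_iff_card_eq_finrank_span, Matrix.rank_eq_finrank_span_row]
  exact eq_comm

/-- The incidence matrix of the directed graph with edge set `X`, one row `e_j - e_i` for each
`(i, j) ∈ X`. -/
noncomputable def signedIncidence {V : Type*} [DecidableEq V] (X : Set (V × V)) :
    Matrix X V ℝ :=
  Matrix.of fun p => Pi.single p.1.2 1 - Pi.single p.1.1 1

theorem mem_ker_signedIncidence {V : Type*} [Fintype V] [DecidableEq V] (X : Set (V × V))
    (φ : V → ℝ) :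
    φ ∈ LinearMap.ker (signedIncidence X).mulVecLin ↔ ∀ a b, (a, b) ∈ X → φ a = φ b := by
  simp only [LinearMap.mem_ker, Matrix.mulVecLin_apply, funext_iff, Matrix.mulVec,
    signedIncidence, Matrix.of_apply, sub_dotProduct, single_one_dotProduct, Pi.zero_apply,
    sub_eq_zero, Subtype.forall, Prod.forall]
  exact forall₃_congr fun _ _ _ => eq_comm

/-- The kernel of the incidence matrix is a line iff the underlying graph is connected. -/
theorem finrank_ker_signedIncidence_eq_one_iff {V : Type*} [Fintype V] [DecidableEq V] [Nonempty V]
    (X : Set (V × V)) :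
    Module.finrank ℝ (LinearMap.ker (signedIncidence X).mulVecLin) = 1 ↔
      (SimpleGraph.fromRel (fun a b => (a, b) ∈ X)).Connected := by
  set G := SimpleGraph.fromRel (fun a b => (a, b) ∈ X) with hG
  let one : LinearMap.ker (signedIncidence X).mulVecLin :=
    ⟨fun _ => 1, (mem_ker_signedIncidence X _).2 fun _ _ _ => rfl⟩
  have h_one : one ≠ 0 := fun h =>
    one_ne_zero (congrFun (congrArg Subtype.val h) (Classical.arbitrary V))
  rw [finrank_eq_one_iff_of_nonzero' one h_one]
  constructor
  · intro h
    refine SimpleGraph.Connected.mk fun u v => ?_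
    classical
    obtain ⟨c, hc⟩ := h ⟨fun x => if G.Reachable u x then 1 else 0,
      (mem_ker_signedIncidence X _).2 fun a b hab => by
        have : G.Reachable a b := by
          rcases eq_or_ne a b with rfl | hne
          · rfl
          · exact SimpleGraph.Adj.reachable ((SimpleGraph.fromRel_adj _ _ _).2 ⟨hne, Or.inl hab⟩)
        have : G.Reachable u a ↔ G.Reachable u b :=
          ⟨fun h => h.trans this, fun h => h.trans this.symm⟩
        simp only [this]⟩
    have hx (x : V) : c = if G.Reachable u x then 1 else 0 := by
      simpa [one] using congrFun (congrArg Subtype.val hc) x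
    have hu := hx u
    rw [if_pos (SimpleGraph.Reachable.refl u)] at hu
    by_contra hv
    have hv' := hx v
    rw [if_neg hv, hu] at hv'
    exact one_ne_zero hv'
  · rintro h ⟨φ, hφ⟩
    rw [mem_ker_signedIncidence] at hφ
    have hadj (a b : V) (hab : G.Adj a b) : φ a = φ b := by
      rcases ((SimpleGraph.fromRel_adj _ _ _).1 hab).2 with h | h
      · exact hφ _ _ h
      · exact (hφ _ _ h).symm
    have hconst (a b : V) : φ a = φ b := by
      obtain ⟨w⟩ := h.preconnected a b
      induction w with
      | nil => rfl
      | cons hab _ ih => exact (hadj _ _ hab).trans ih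
    refine ⟨φ (Classical.arbitrary V), Subtype.ext (funext fun x => ?_)⟩
    simpa [one] using hconst _ _

theorem ncard_edgeSet_fromRel {V : Type*} (I : Set V) (X : Set (V × V))
    (hX : ∀ p ∈ X, p.1 ∈ I ∧ p.2 ∉ I) :
    (SimpleGraph.fromRel (fun a b => (a, b) ∈ X)).edgeSet.ncard = X.ncard := by
  have himage : (SimpleGraph.fromRel (fun a b => (a, b) ∈ X)).edgeSet =
      (fun p : V × V => s(p.1, p.2)) '' X := by
    ext e
    induction e with | _ a b =>
    simp only [SimpleGraph.mem_edgeSet, SimpleGraph.fromRel_adj, Set.mem_image, Prod.exists,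
      Sym2.eq_iff]
    constructor
    · rintro ⟨-, h | h⟩
      · exact ⟨a, b, h, Or.inl ⟨rfl, rfl⟩⟩
      · exact ⟨b, a, h, Or.inr ⟨rfl, rfl⟩⟩
    · rintro ⟨c, d, h, ⟨rfl, rfl⟩ | ⟨rfl, rfl⟩⟩
      · exact ⟨fun hcd => (hX _ h).2 (hcd ▸ (hX _ h).1), Or.inl h⟩
      · exact ⟨fun hcd => (hX _ h).2 (hcd ▸ (hX _ h).1), Or.inr h⟩
  rw [himage, Set.InjOn.ncard_image]
  rintro ⟨a, b⟩ h ⟨c, d⟩ h' hs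
  rcases Sym2.eq_iff.1 hs with ⟨rfl, rfl⟩ | ⟨rfl, rfl⟩
  · rfl
  · exact absurd (hX _ h').1 (hX _ h).2

theorem affineIndependent_vtx_iff {n : ℕ} (I : Finset (Fin n)) (X : Set (Fin n × Fin n))
    (hX : ∀ p ∈ X, p.1 ∈ I ∧ p.2 ∉ I) :
    AffineIndependent ℝ (fun p : X => vtx I p.1) ↔
      LinearIndependent ℝ (signedIncidence X).row := by
  rw [← affineIndependent_add_const_iff (fun x => if x ∈ I then (1 : ℝ) else 0) _
    (∑ x ∈ Iᶜ, LinearMap.proj x)]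
  · apply iff_of_eq
    congr 1
    ext p x
    simp only [vtx, signedIncidence, Matrix.row, Matrix.of_apply, Pi.add_apply, Pi.sub_apply,
      Pi.single_apply]
    ring
  · intro p
    have h := hX p.1 p.2
    simp [signedIncidence, Matrix.row, Pi.single_apply, Finset.sum_sub_distrib, h.1, h.2]

/-- For `X ⊆ I × J` (`J` the complement of the `k`-set `I`), the points
`e_I - e_i + e_j`, `(i,j) ∈ X`, are the vertex set of an `(n-2)`-dimensional simplex
(i.e. there are `n-1` of them and they are affinely independent) if and only if the
bipartite graph `G(X)` on `[n]` is a (spanning) tree. -/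
theorem stmt_12 (k n : ℕ) (hk : 0 < k) (hkn : k < n) (I : Finset (Fin n)) (hI : I.card = k)
    (X : Set (Fin n × Fin n)) (hX : ∀ p ∈ X, p.1 ∈ I ∧ p.2 ∉ I) :
    (X.ncard = n - 1 ∧ AffineIndependent ℝ (fun p : X => vtx I p.1)) ↔
      (SimpleGraph.fromRel (fun a b => (a, b) ∈ X)).IsTree := by
  have : NeZero n := ⟨by omega⟩
  classical
  have hcard : Fintype.card X = X.ncard := by rw [← Nat.card_coe_set_eq, Nat.card_eq_fintype_card]
  have hrank := (signedIncidence X).mulVecLin.finrank_range_add_finrank_ker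
  rw [Module.finrank_fin_fun, ← Matrix.rank] at hrank
  rw [affineIndependent_vtx_iff I X hX, Matrix.linearIndependent_row_iff_rank_eq,
    SimpleGraph.isTree_iff_connected_and_card, Nat.card_coe_set_eq,
    ncard_edgeSet_fromRel (I : Set (Fin n)) X (by simpa using hX), Nat.card_fin,
    ← finrank_ker_signedIncidence_eq_one_iff, hcard]
  omega
end

section
/- Fix 0 < k < n. The map Trop Ψ : ℝ^{k(n−k)} → ℝ^{k(n−k)} defined as follows is injective. The domain consists of tuples (P_{K(i,j)}) indexed by 1 ≤ i ≤ k and k+1 ≤ j ≤ n, with the convention P_{K(i,j)} := 0 whenever K(i,j) = {1,…,k} (in particular for out-of-range pairs (i,j)); the map sends such a tuple to the tuple with entries Trop Ψ(P)_{(i,j)} = ( P_{K(i,j)} + P_{K(i+1,j−2)} + P_{K(i+2,j−1)} ) − ( P_{K(i,j−1)} + P_{K(i+1,j)} + P_{K(i+2,j−2)} ), for 1 ≤ i ≤ k and k+1 ≤ j ≤ n. -/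
/-- `(i, j)` indexes a face of the web `W_{k,n}`: `1 ≤ i ≤ k` and `k+1 ≤ j ≤ n`.
For out-of-range pairs the corresponding set `K(i,j)` is `{1,…,k}`, whose tropical
Plücker coordinate is normalized to `0`. -/
def InRange (k n i j : ℕ) : Prop := 1 ≤ i ∧ i ≤ k ∧ k + 1 ≤ j ∧ j ≤ n

/-- The `(i,j)` entry of the map `Trop Ψ`, applied to a tuple
`P : ℕ × ℕ → ℝ` of tropical Plücker coordinates `P (i, j) = P_{K(i,j)}` (with the
convention that out-of-range entries, corresponding to `K(i,j) = {1,…,k}`, are `0`). -/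
def tropPsi (k n : ℕ) (P : ℕ × ℕ → ℝ) (i j : ℕ) : ℝ :=
  (P (i, j) + P (i + 1, j - 2) + P (i + 2, j - 1)) -
    (P (i, j - 1) + P (i + 1, j) + P (i + 2, j - 2))

/-- The map `Trop Ψ : ℝ^{k(n-k)} → ℝ^{k(n-k)}` is injective: two tuples of corectangle
tropical Plücker coordinates (normalized to vanish out of range, i.e. on
`K(i,j) = {1,…,k}`) with the same image under `Trop Ψ` are equal. -/
theorem stmt_14 (k n : ℕ) (hk : 0 < k) (hkn : k < n) (P Q : ℕ × ℕ → ℝ)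
    (hP0 : ∀ i j : ℕ, ¬ InRange k n i j → P (i, j) = 0)
    (hQ0 : ∀ i j : ℕ, ¬ InRange k n i j → Q (i, j) = 0)
    (h : ∀ i j : ℕ, InRange k n i j → tropPsi k n P i j = tropPsi k n Q i j) :
    P = Q := by
  have rows : ∀ m i j : ℕ, k < i + m → P (i, j) = Q (i, j) := by
    intro m
    induction m with
    | zero =>
      intro i j hi
      have hout : ¬ InRange k n i j := fun hr => by
        have := hr.2.1
        omega
      rw [hP0 i j hout, hQ0 i j hout]
    | succ m ih =>
      intro i j hi
      induction j using Nat.strong_induction_on with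
      | _ j ihj =>
        by_cases hr : InRange k n i j
        · have hj : j - 1 < j := by
            have := hr.2.2.1
            omega
          have hij := h i j hr
          unfold tropPsi at hij
          rw [ih (i + 1) (j - 2) (by omega), ih (i + 2) (j - 1) (by omega),
            ih (i + 1) j (by omega), ih (i + 2) (j - 2) (by omega), ihj (j - 1) hj] at hij
          linarith
        · rw [hP0 i j hr, hQ0 i j hr]
  funext ⟨i, j⟩
  exact rows (k + 1) i j (by omega)
end
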